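/- Let K be an algebraically closed field of characteristic 0 and let m ≥ 5. Suppose the Gelfand–Kirillov conjecture holds for so_m(K), i.e. there exist natural numbers r, s and a K-algebra isomorphism D(so_m(K)) ≅ D_{r,s}(K). Then there exists N ∈ ℕ such that for every prime p > N, taking k to be an algebraic closure of 𝔽_p, there exist natural numbers r′, s′ and a k-algebra isomorphism D(so_m(k)) ≅ D_{r′,s′}(k). (This is the paper's reduction theorem — if the Gelfand–Kirillov conjecture holds in characteristic 0 then it holds modulo p for all p ≫ 0 — instantiated at the orthogonal Lie algebras.) -/

import Mathlib

noncomputable section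

/-- Generators of the algebra `A_{r,s}(F)`:  `u_1, …, u_r, v_1, …, v_r, y_1, …, y_s`. -/
inductive WeylPolyGen (r s : ℕ) : Type
  | u : Fin r → WeylPolyGen r s
  | v : Fin r → WeylPolyGen r s
  | y : Fin s → WeylPolyGen r s

/-- The defining relations of `A_{r,s}(F)`:  `u_i u_j = u_j u_i`, `v_i v_j = v_j v_i`,
`u_i v_j = v_j u_i + δ_{ij}`, and each `y_k` commutes with every generator. -/
inductive WeylPolyRel (F : Type) [Field F] (r s : ℕ) :
    FreeAlgebra F (WeylPolyGen r s) → FreeAlgebra F (WeylPolyGen r s) → Prop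
  | uu (i j : Fin r) :
      WeylPolyRel F r s
        (FreeAlgebra.ι F (WeylPolyGen.u i) * FreeAlgebra.ι F (WeylPolyGen.u j))
        (FreeAlgebra.ι F (WeylPolyGen.u j) * FreeAlgebra.ι F (WeylPolyGen.u i))
  | vv (i j : Fin r) :
      WeylPolyRel F r s
        (FreeAlgebra.ι F (WeylPolyGen.v i) * FreeAlgebra.ι F (WeylPolyGen.v j))
        (FreeAlgebra.ι F (WeylPolyGen.v j) * FreeAlgebra.ι F (WeylPolyGen.v i))
  | uv (i j : Fin r) :
      WeylPolyRel F r s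
        (FreeAlgebra.ι F (WeylPolyGen.u i) * FreeAlgebra.ι F (WeylPolyGen.v j))
        (FreeAlgebra.ι F (WeylPolyGen.v j) * FreeAlgebra.ι F (WeylPolyGen.u i)
          + if i = j then 1 else 0)
  | central (a : Fin s) (z : WeylPolyGen r s) :
      WeylPolyRel F r s
        (FreeAlgebra.ι F (WeylPolyGen.y a) * FreeAlgebra.ι F z)
        (FreeAlgebra.ι F z * FreeAlgebra.ι F (WeylPolyGen.y a))

/-- The algebra `A_{r,s}(F)`, the tensor product of the `r`-th Weyl algebra over `F`
with a polynomial ring in `s` variables. -/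
abbrev WeylPolyAlgebra (F : Type) [Field F] (r s : ℕ) : Type :=
  RingQuot (WeylPolyRel F r s)

/-- `f : R →ₐ[F] D` realises the division ring `D` as the (left) Ore division ring of
fractions of `R`:  `f` is injective and every element of `D` has the form
`(f b)⁻¹ * f a` with `a b : R`, `b ≠ 0`. -/
def IsFractionDivisionRing (F : Type) [Field F] {R D : Type} [Ring R] [Algebra F R]
    [DivisionRing D] [Algebra F D] (f : R →ₐ[F] D) : Prop :=
  Function.Injective f ∧ ∀ d : D, ∃ a b : R, b ≠ 0 ∧ f b * d = f a

/-- A witness to the Gelfand–Kirillov conjecture for the Lie algebra `L` over `F`: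
natural numbers `r, s`, a division ring of fractions `D₁` of the universal enveloping
algebra `U(L)`, a division ring of fractions `D₂` of `A_{r,s}(F)`, and an `F`-algebra
isomorphism `D₁ ≃ D₂`. -/
structure GelfandKirillovWitness (F : Type) [Field F]
    (L : Type) [LieRing L] [LieAlgebra F L] : Type 1 where
  r : ℕ
  s : ℕ
  D₁ : Type
  D₂ : Type
  [div₁ : DivisionRing D₁]
  [div₂ : DivisionRing D₂]
  [alg₁ : Algebra F D₁]
  [alg₂ : Algebra F D₂]
  f₁ : UniversalEnvelopingAlgebra F L →ₐ[F] D₁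
  f₂ : WeylPolyAlgebra F r s →ₐ[F] D₂
  frac₁ : IsFractionDivisionRing F f₁
  frac₂ : IsFractionDivisionRing F f₂
  iso : D₁ ≃ₐ[F] D₂

/-- The Gelfand–Kirillov conjecture holds for the Lie algebra `L` over the field `F`:
the division ring of fractions `D(L)` of `U(L)` is isomorphic, as an `F`-algebra, to
`D_{r,s}(F)` (the division ring of fractions of `A_{r,s}(F)`) for some `r, s`. -/
def GelfandKirillovHolds (F : Type) [Field F]
    (L : Type) [LieRing L] [LieAlgebra F L] : Prop :=
  Nonempty (GelfandKirillovWitness F L)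

section ReductionModP

open MvPolynomial

/-! ### Filtrations by word weight -/

section WordFiltration

variable {F ι B : Type*} [Field F] [Ring B] [Algebra F B]

/-- The span of the words in the family `x` of weight less than `n`. -/
def wordFil (F : Type*) {ι B : Type*} [Field F] [Ring B] [Algebra F B] (x : ι → B) (w : ι → ℕ)
    (n : ℕ) : Submodule F B :=
  Submodule.span F {b | ∃ l : List ι, (l.map w).sum < n ∧ (l.map x).prod = b}

/-- The span of the words in the family `x` of length less than `n`. -/
abbrev lengthFil (F : Type*) {ι B : Type*} [Field F] [Ring B] [Algebra F B] (x : ι → B)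
    (n : ℕ) : Submodule F B :=
  wordFil F x (fun _ => 1) n

variable {x : ι → B} {w : ι → ℕ}

lemma wordFil_mono {m n : ℕ} (h : m ≤ n) : wordFil F x w m ≤ wordFil F x w n :=
  Submodule.span_mono fun _ ⟨l, hl, e⟩ => ⟨l, hl.trans_le h, e⟩

lemma word_mem_wordFil {n : ℕ} (l : List ι) (h : (l.map w).sum < n) :
    (l.map x).prod ∈ wordFil F x w n :=
  Submodule.subset_span ⟨l, h, rfl⟩

lemma word_mem_lengthFil {n : ℕ} (l : List ι) (h : l.length < n) :
    (l.map x).prod ∈ lengthFil F x n :=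
  word_mem_wordFil l (by simpa using h)

lemma gen_mem_wordFil (j : ι) : x j ∈ wordFil F x w (w j + 1) := by
  simpa using word_mem_wordFil (F := F) (x := x) (w := w) (n := w j + 1) [j] (by simp)

lemma wordFil_zero : wordFil F x w 0 = ⊥ := by
  simp [wordFil]

lemma one_mem_wordFil {n : ℕ} (h : 0 < n) : (1 : B) ∈ wordFil F x w n := by
  simpa using word_mem_wordFil (F := F) (x := x) (w := w) (n := n) [] (by simpa using h)

lemma wordFil_induction {n : ℕ} {P : B → Prop}
    (word : ∀ l : List ι, (l.map w).sum < n → P (l.map x).prod) (zero : P 0)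
    (add : ∀ a b, P a → P b → P (a + b)) (smul : ∀ (c : F) a, P a → P (c • a))
    {b : B} (hb : b ∈ wordFil F x w n) : P b := by
  induction hb using Submodule.span_induction with
  | mem b hb => obtain ⟨l, hl, rfl⟩ := hb; exact word l hl
  | zero => exact zero
  | add a b _ _ ha hb => exact add a b ha hb
  | smul c a _ ha => exact smul c a ha

lemma mul_mem_wordFil {m n k : ℕ} (h : m + n ≤ k + 1) {a b : B}
    (ha : a ∈ wordFil F x w m) (hb : b ∈ wordFil F x w n) : a * b ∈ wordFil F x w k := by
  refine wordFil_induction (P := fun a => a * b ∈ wordFil F x w k) ?_ (by simp)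
    (fun a a' h h' => by simpa [add_mul] using add_mem h h')
    (fun c a h => by simpa using Submodule.smul_mem _ c h) ha
  intro l hl
  refine wordFil_induction (P := fun b => (l.map x).prod * b ∈ wordFil F x w k) ?_ (by simp)
    (fun a a' h h' => by simpa [mul_add] using add_mem h h')
    (fun c a h => by simpa using Submodule.smul_mem _ c h) hb
  intro l' hl'
  rw [← List.prod_append, ← List.map_append]
  exact word_mem_wordFil _ (by simp; omega)

lemma exists_mem_wordFil (h : Algebra.adjoin F (Set.range x) = ⊤) (b : B) :
    ∃ n, b ∈ wordFil F x w n := by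
  have hb : b ∈ Algebra.adjoin F (Set.range x) := h ▸ Algebra.mem_top
  induction hb using Algebra.adjoin_induction with
  | mem b hb => obtain ⟨j, rfl⟩ := hb; exact ⟨_, gen_mem_wordFil j⟩
  | algebraMap c =>
    refine ⟨1, ?_⟩
    rw [Algebra.algebraMap_eq_smul_one]
    exact Submodule.smul_mem _ _ (one_mem_wordFil one_pos)
  | add a b _ _ ha hb =>
    obtain ⟨m, hm⟩ := ha
    obtain ⟨n, hn⟩ := hb
    exact ⟨max m n, add_mem (wordFil_mono (le_max_left _ _) hm)
      (wordFil_mono (le_max_right _ _) hn)⟩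
  | mul a b _ _ ha hb =>
    obtain ⟨m, hm⟩ := ha
    obtain ⟨n, hn⟩ := hb
    exact ⟨m + n, mul_mem_wordFil (by omega) hm hn⟩

lemma map_mem_wordFil {ι' C : Type*} [Ring C] [Algebra F C] {y : ι' → C} {v : ι' → ℕ}
    (φ : B →ₐ[F] C) (hφ : ∀ j, φ (x j) ∈ wordFil F y v (w j + 1)) {n : ℕ} {b : B}
    (hb : b ∈ wordFil F x w n) : φ b ∈ wordFil F y v n := by
  have key : ∀ l : List ι, φ (l.map x).prod ∈ wordFil F y v ((l.map w).sum + 1) := by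
    intro l
    induction l with
    | nil => simpa using one_mem_wordFil one_pos
    | cons j l ih =>
      simp only [List.map_cons, List.prod_cons, map_mul, List.sum_cons]
      exact mul_mem_wordFil (by omega) (hφ j) ih
  exact wordFil_induction (P := fun b => φ b ∈ wordFil F y v n)
    (fun l hl => wordFil_mono hl (key l)) (by simp)
    (fun a b ha hb => by simpa using add_mem ha hb)
    (fun c a ha => by simpa using Submodule.smul_mem _ c ha) hb

end WordFiltration

/-! ### Algebras with a Poincaré–Birkhoff–Witt property -/

/-- The algebra `B` is generated by the family `x`, the commutators of the generators have
filtration degree at most one, and the associated graded algebra is the polynomial ring; the last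
condition is expressed by a linear symbol map to the polynomial ring. -/
structure HasPBW (F : Type*) {ι B : Type*} [Field F] [Ring B] [Algebra F B] (x : ι → B) :
    Prop where
  adjoin_eq_top : Algebra.adjoin F (Set.range x) = ⊤
  commutator_mem : ∀ i j, x i * x j - x j * x i ∈ lengthFil F x 2
  exists_symbol : ∃ σ : B →ₗ[F] MvPolynomial ι F, ∀ l : List ι,
    σ (l.map x).prod - (l.map X).prod ∈ lengthFil F (X : ι → MvPolynomial ι F) l.length

section PBW

variable {F ι B : Type*} [Field F] [Ring B] [Algebra F B] {x : ι → B}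

/-- The linear map sending a monomial to a word in the family `x`. -/
def wordMap (F : Type*) {ι B : Type*} [Field F] [Ring B] [Algebra F B] (x : ι → B) :
    MvPolynomial ι F →ₗ[F] B :=
  (basisMonomials ι F).constr F fun s => (s.toMultiset.toList.map x).prod

lemma wordMap_monomial (s : ι →₀ ℕ) (c : F) :
    wordMap F x (monomial s c) = c • (s.toMultiset.toList.map x).prod := by
  have : monomial s c = c • basisMonomials ι F s := by simp [smul_monomial]
  rw [this, map_smul, wordMap, Module.Basis.constr_basis]

open Classical in
lemma prod_map_X (l : List ι) :
    (l.map (X : ι → MvPolynomial ι F)).prod = monomial (Multiset.toFinsupp (l : Multiset ι)) 1 := by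
  induction l with
  | nil => simp
  | cons j l ih =>
    rw [List.map_cons, List.prod_cons, ih, X, monomial_mul, ← Multiset.cons_coe,
      ← Multiset.singleton_add, map_add]
    simp

lemma wordMap_prod_map_X (l : List ι) :
    wordMap F x (l.map X).prod = ((l : Multiset ι).toList.map x).prod := by
  classical
  rw [prod_map_X, wordMap_monomial, one_smul, Multiset.toFinsupp_toMultiset]

lemma isHomogeneous_prod_map_X (l : List ι) :
    ((l.map (X : ι → MvPolynomial ι F)).prod).IsHomogeneous l.length := by
  induction l with
  | nil => simpa using isHomogeneous_one ι F
  | cons j l ih =>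
    simpa [add_comm] using (isHomogeneous_X F j).mul ih

lemma homogeneousComponent_eq_zero_of_mem {n d : ℕ} (h : n ≤ d) {P : MvPolynomial ι F}
    (hP : P ∈ lengthFil F X n) : homogeneousComponent d P = 0 := by
  refine wordFil_induction (P := fun P => homogeneousComponent d P = 0) ?_ (by simp)
    (fun a b ha hb => by simp [ha, hb]) (fun c a ha => by simp [ha]) hP
  intro l hl
  rw [homogeneousComponent_of_mem (isHomogeneous_prod_map_X l), if_neg]
  simp at hl; omega

lemma perm_sub_mem (hx : ∀ i j, x i * x j - x j * x i ∈ lengthFil F x 2) {l l' : List ι}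
    (h : l.Perm l') : (l.map x).prod - (l'.map x).prod ∈ lengthFil F x l.length := by
  induction h with
  | nil => simp
  | @cons j l l' _ ih =>
    simp only [List.map_cons, List.prod_cons, ← mul_sub, List.length_cons]
    exact mul_mem_wordFil (by omega) (gen_mem_wordFil (w := fun _ => 1) j) ih
  | swap i j l =>
    simp only [List.map_cons, List.prod_cons, ← mul_assoc, ← sub_mul, List.length_cons]
    exact mul_mem_wordFil (by omega) (hx j i) (word_mem_lengthFil l (Nat.lt_succ_self _))
  | trans h h' ih ih₂ =>
    rw [← sub_add_sub_cancel]
    exact add_mem ih (h.length_eq ▸ ih₂)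

/-- The symbol of degree `n`. -/
def gradedSymbol (σ : B →ₗ[F] MvPolynomial ι F) (n : ℕ) : B →ₗ[F] MvPolynomial ι F :=
  homogeneousComponent n ∘ₗ σ

variable {σ : B →ₗ[F] MvPolynomial ι F}

lemma gradedSymbol_word
    (hσ : ∀ l : List ι, σ (l.map x).prod - (l.map X).prod ∈ lengthFil F X l.length)
    {n : ℕ} (l : List ι) (h : l.length ≤ n) :
    gradedSymbol σ n (l.map x).prod = if l.length = n then (l.map X).prod else 0 := by
  have h1 := homogeneousComponent_eq_zero_of_mem h (hσ l)
  rw [map_sub, sub_eq_zero] at h1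
  rw [gradedSymbol, LinearMap.comp_apply, h1,
    homogeneousComponent_of_mem (isHomogeneous_prod_map_X l)]
  simp only [eq_comm]

lemma gradedSymbol_eq_zero
    (hσ : ∀ l : List ι, σ (l.map x).prod - (l.map X).prod ∈ lengthFil F X l.length)
    {n d : ℕ} (h : n ≤ d) {b : B} (hb : b ∈ lengthFil F x n) : gradedSymbol σ d b = 0 := by
  refine wordFil_induction (P := fun b => gradedSymbol σ d b = 0) ?_ (by simp)
    (fun a b ha hb => by simp [ha, hb]) (fun c a ha => by simp [ha]) hb
  intro l hl
  simp at hl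
  rw [gradedSymbol_word hσ l (by omega), if_neg (by omega)]

lemma gradedSymbol_mul
    (hσ : ∀ l : List ι, σ (l.map x).prod - (l.map X).prod ∈ lengthFil F X l.length)
    {m n : ℕ} {a b : B} (ha : a ∈ lengthFil F x (m + 1)) (hb : b ∈ lengthFil F x (n + 1)) :
    gradedSymbol σ (m + n) (a * b) = gradedSymbol σ m a * gradedSymbol σ n b := by
  refine wordFil_induction (P := fun a => gradedSymbol σ (m + n) (a * b) = gradedSymbol σ m a *
    gradedSymbol σ n b) ?_ (by simp) (fun a b ha hb => by simp [ha, hb, add_mul])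
    (fun c a ha => by simp [ha]) ha
  intro l hl
  refine wordFil_induction (P := fun b => gradedSymbol σ (m + n) (_ * b) = gradedSymbol σ m _ *
    gradedSymbol σ n b) ?_ (by simp) (fun a b ha hb => by simp [ha, hb, mul_add])
    (fun c a ha => by simp [ha]) hb
  intro l' hl'
  simp at hl hl'
  rw [← List.prod_append, ← List.map_append, gradedSymbol_word hσ _ (by simp; omega),
    gradedSymbol_word hσ _ (by omega), gradedSymbol_word hσ _ (by omega)]
  simp only [List.length_append, List.map_append, List.prod_append]
  split_ifs <;> first | omega | simp

lemma sub_wordMap_gradedSymbol_mem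
    (hx : ∀ i j, x i * x j - x j * x i ∈ lengthFil F x 2)
    (hσ : ∀ l : List ι, σ (l.map x).prod - (l.map X).prod ∈ lengthFil F X l.length)
    {n : ℕ} {b : B} (hb : b ∈ lengthFil F x (n + 1)) :
    b - wordMap F x (gradedSymbol σ n b) ∈ lengthFil F x n := by
  refine wordFil_induction (P := fun b => b - wordMap F x (gradedSymbol σ n b) ∈ lengthFil F x n)
    ?_ (by simp)
    (fun a b ha hb => by simpa [add_sub_add_comm] using add_mem ha hb)
    (fun c a ha => by simpa [smul_sub] using Submodule.smul_mem _ c ha) hb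
  intro l hl
  simp at hl
  rw [gradedSymbol_word hσ _ (by omega)]
  split_ifs with h
  · rw [wordMap_prod_map_X, ← h]
    exact perm_sub_mem hx (Multiset.coe_eq_coe.1 (by simp))
  · simpa using word_mem_lengthFil l (by omega)

lemma exists_gradedSymbol_ne_zero (h : Algebra.adjoin F (Set.range x) = ⊤)
    (hx : ∀ i j, x i * x j - x j * x i ∈ lengthFil F x 2)
    (hσ : ∀ l : List ι, σ (l.map x).prod - (l.map X).prod ∈ lengthFil F X l.length)
    {b : B} (hb : b ≠ 0) : ∃ n, b ∈ lengthFil F x (n + 1) ∧ gradedSymbol σ n b ≠ 0 := by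
  classical
  have hex := exists_mem_wordFil (w := fun _ => 1) h b
  have h0 : Nat.find hex ≠ 0 := fun h0 => hb <| by
    have := Nat.find_spec hex
    rwa [h0, wordFil_zero, Submodule.mem_bot] at this
  obtain ⟨n, hn⟩ := Nat.exists_eq_succ_of_ne_zero h0
  have hmem : b ∈ lengthFil F x (n + 1) := by
    have := Nat.find_spec hex
    rwa [hn] at this
  refine ⟨n, hmem, fun h => ?_⟩
  refine Nat.find_min hex (m := n) (by omega) ?_
  simpa [h] using sub_wordMap_gradedSymbol_mem hx hσ hmem

lemma MvPolynomial.exists_homogeneousComponent_ne_zero {P : MvPolynomial ι F} (hP : P ≠ 0) :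
    ∃ n, P ∈ lengthFil F X (n + 1) ∧ homogeneousComponent n P ≠ 0 := by
  have := exists_gradedSymbol_ne_zero (F := F) (x := (X : ι → MvPolynomial ι F))
    (σ := LinearMap.id) adjoin_range_X
    (fun i j => by simp [mul_comm]) (fun l => by simp) hP
  simpa [gradedSymbol] using this

lemma HasPBW.noZeroDivisors (h : HasPBW F x) : NoZeroDivisors B := by
  obtain ⟨σ, hσ⟩ := h.exists_symbol
  refine ⟨fun {a b} hab => ?_⟩
  by_contra! hne
  obtain ⟨m, ham, ha⟩ := exists_gradedSymbol_ne_zero h.adjoin_eq_top h.commutator_mem hσ hne.1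
  obtain ⟨n, hbn, hb⟩ := exists_gradedSymbol_ne_zero h.adjoin_eq_top h.commutator_mem hσ hne.2
  refine mul_ne_zero ha hb ?_
  rw [← gradedSymbol_mul hσ ham hbn, hab, map_zero]

lemma HasPBW.nontrivial (h : HasPBW F x) : Nontrivial B := by
  obtain ⟨σ, hσ⟩ := h.exists_symbol
  refine ⟨1, 0, fun h => ?_⟩
  have := hσ []
  simp [h, wordFil_zero] at this

lemma HasPBW.isDomain (h : HasPBW F x) : IsDomain B :=
  have := h.noZeroDivisors
  have := h.nontrivial
  NoZeroDivisors.to_isDomain B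

lemma HasPBW.wordMap_injective (h : HasPBW F x) : Function.Injective (wordMap F x) := by
  obtain ⟨σ, hσ⟩ := h.exists_symbol
  rw [injective_iff_map_eq_zero]
  intro P hP
  by_contra hne
  obtain ⟨n, hPn, hn⟩ := exists_homogeneousComponent_ne_zero hne
  refine hn ?_
  have : gradedSymbol σ n (wordMap F x P) = homogeneousComponent n P := by
    refine wordFil_induction (P := fun P => gradedSymbol σ n (wordMap F x P) =
      homogeneousComponent n P) ?_ (by simp)
      (fun a b ha hb => by simp [ha, hb]) (fun c a ha => by simp [ha]) hPn
    intro l hl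
    simp at hl
    have hl' : (l : Multiset ι).toList.length = l.length := by simp
    rw [wordMap_prod_map_X, gradedSymbol_word hσ _ (by omega), hl',
      homogeneousComponent_of_mem (isHomogeneous_prod_map_X l)]
    have : ((l : Multiset ι).toList.map (X : ι → MvPolynomial ι F)).prod = (l.map X).prod := by
      refine List.Perm.prod_eq (List.Perm.map _ (Multiset.coe_eq_coe.1 (by simp)))
    simp only [this, eq_comm]
  rw [← this, hP, map_zero]

lemma HasPBW.wordMap_surjective (h : HasPBW F x) : Function.Surjective (wordMap F x) := by
  obtain ⟨σ, hσ⟩ := h.exists_symbol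
  have key : ∀ n b, b ∈ lengthFil F x n → b ∈ LinearMap.range (wordMap F x) := by
    intro n
    induction n with
    | zero => intro b hb; rw [lengthFil, wordFil_zero, Submodule.mem_bot] at hb; simp [hb]
    | succ n ih =>
      intro b hb
      have := add_mem (ih _ (sub_wordMap_gradedSymbol_mem h.commutator_mem hσ hb))
        (LinearMap.mem_range_self (wordMap F x) (gradedSymbol σ n b))
      simpa using this
  intro b
  obtain ⟨n, hn⟩ := exists_mem_wordFil (w := fun _ => 1) h.adjoin_eq_top b
  exact key n b hn

end PBW

/-! ### Central polynomial subalgebras in positive characteristic -/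

section CentralPoly

variable {F ι B : Type*} [Field F] [Ring B] [Algebra F B] {x : ι → B}

/-- The algebra `B` is integral over a central polynomial subalgebra with variables `ι`. -/
structure IsCentralPoly {F ι B : Type*} [Field F] [Ring B] [Algebra F B]
    (τ : MvPolynomial ι F →ₐ[F] B) : Prop where
  comm : ∀ P b, τ P * b = b * τ P
  injective : Function.Injective τ
  integral : ∀ b : B, (τ : MvPolynomial ι F →+* B).IsIntegralElem b

/-- The evaluation homomorphism at central elements. -/
def centralAeval (F : Type*) {ι B : Type*} [Field F] [Ring B] [Algebra F B] (z : ι → B)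
    (hz : ∀ j b, z j * b = b * z j) : MvPolynomial ι F →ₐ[F] B :=
  (Subalgebra.center F B).val.comp
    (aeval fun j => (⟨z j, Subalgebra.mem_center_iff.2 fun b => (hz j b).symm⟩ :
      Subalgebra.center F B))

lemma centralAeval_X {z : ι → B} (hz : ∀ j b, z j * b = b * z j) (j : ι) :
    centralAeval F z hz (X j) = z j := by
  simp [centralAeval]

lemma centralAeval_comm {z : ι → B} (hz : ∀ j b, z j * b = b * z j) (P : MvPolynomial ι F)
    (b : B) : centralAeval F z hz P * b = b * centralAeval F z hz P := by
  have : centralAeval F z hz P ∈ Subalgebra.center F B := SetLike.coe_mem _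
  exact (Subalgebra.mem_center_iff.1 this b).symm

lemma exists_count_ge [Fintype ι] [DecidableEq ι] {p : ℕ} {l : List ι}
    (h : Fintype.card ι * p < l.length) : ∃ j, p ≤ l.count j := by
  by_contra! hc
  have : l.length = ∑ j, l.count j := by
    simpa using (Multiset.sum_count_eq_card (s := Finset.univ) (m := (l : Multiset ι))
      (by simp)).symm
  have h2 : ∑ j, l.count j ≤ ∑ _j : ι, p := Finset.sum_le_sum fun j _ => (hc j).le
  simp at h2
  omega

lemma HasPBW.isCentralPoly [Finite ι] (h : HasPBW F x) {p : ℕ} (hp : 2 ≤ p) (z : ι → B)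
    (hz : ∀ j b, z j * b = b * z j) (hzx : ∀ j, z j - x j ^ p ∈ lengthFil F x p) :
    IsCentralPoly (centralAeval F z hz) := by
  classical
  have := Fintype.ofFinite ι
  obtain ⟨σ, hσ⟩ := h.exists_symbol
  have hxp : ∀ j, x j ^ p = ((List.replicate p j).map x).prod := by simp
  have hzmem : ∀ j, z j ∈ lengthFil F x (p + 1) := by
    intro j
    rw [← sub_add_cancel (z j) (x j ^ p)]
    refine add_mem (wordFil_mono (by omega) (hzx j)) ?_
    rw [hxp]
    exact word_mem_lengthFil _ (by simp)
  have hgr : ∀ j, gradedSymbol σ p (z j) = X j ^ p := by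
    intro j
    rw [← sub_add_cancel (z j) (x j ^ p), map_add, gradedSymbol_eq_zero hσ le_rfl (hzx j), zero_add,
      hxp, gradedSymbol_word hσ _ (by simp)]
    simp
  refine ⟨centralAeval_comm hz, ?_, ?_⟩
  · rw [injective_iff_map_eq_zero]
    intro P hP
    by_contra hne
    obtain ⟨n, hPn, hn⟩ := MvPolynomial.exists_homogeneousComponent_ne_zero hne
    refine hn ?_
    have hw : ∀ l : List ι, (l.map z).prod ∈ lengthFil F x (p * l.length + 1) ∧
        gradedSymbol σ (p * l.length) (l.map z).prod = expand p (l.map X).prod := by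
      intro l
      induction l with
      | nil => exact ⟨one_mem_wordFil (by simp), by simpa using gradedSymbol_word hσ [] le_rfl⟩
      | cons j l ih =>
        simp only [List.map_cons, List.prod_cons, List.length_cons, mul_add, mul_one]
        refine ⟨mul_mem_wordFil (by omega) (hzmem j) ih.1, ?_⟩
        rw [add_comm, gradedSymbol_mul hσ (hzmem j) ih.1, hgr, ih.2, map_mul, expand_X]
    have : gradedSymbol σ (p * n) (centralAeval F z hz P) =
        expand p (homogeneousComponent n P) := by
      refine wordFil_induction (P := fun P => gradedSymbol σ (p * n) (centralAeval F z hz P) =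
        expand p (homogeneousComponent n P)) ?_ (by simp)
        (fun a b ha hb => by simp [ha, hb]) (fun c a ha => by simp [ha]) hPn
      intro l hl
      simp only [List.map_const', List.sum_replicate, smul_eq_mul, mul_one] at hl
      rw [homogeneousComponent_of_mem (isHomogeneous_prod_map_X l), map_list_prod, List.map_map,
        show (⇑(centralAeval F z hz) ∘ X) = z from funext (centralAeval_X hz)]
      split_ifs with h
      · rw [h, (hw l).2]
      · rw [map_zero, gradedSymbol_eq_zero hσ _ (hw l).1]
        have : p * (l.length + 1) ≤ p * n := Nat.mul_le_mul_left _ (by omega)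
        rw [mul_add] at this
        omega
    rw [hP, map_zero] at this
    exact expand_injective (R := F) (σ := ι) (n := p) (by omega) (by rw [← this, map_zero])
  · let τ := centralAeval F z hz
    let _ : Algebra (MvPolynomial ι F) B := τ.toRingHom.toAlgebra' (centralAeval_comm hz)
    have hsmul : ∀ (P : MvPolynomial ι F) (b : B), P • b = τ P * b := fun P b => rfl
    let L := Fintype.card ι * p
    let S : Set B := {b | ∃ l : List ι, l.length ≤ L ∧ (l.map x).prod = b}
    have hS : S.Finite := by
      refine ((List.finite_length_le ι L).image fun l => (l.map x).prod).subset ?_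
      rintro _ ⟨l, hl, rfl⟩
      exact ⟨l, hl, rfl⟩
    have key : ∀ n, ∀ b ∈ lengthFil F x n, b ∈ Submodule.span (MvPolynomial ι F) S := by
      intro n
      induction n with
      | zero => intro b hb; rw [lengthFil, wordFil_zero, Submodule.mem_bot] at hb; simp [hb]
      | succ n ih =>
        intro b hb
        refine wordFil_induction (P := fun b => b ∈ Submodule.span (MvPolynomial ι F) S)
          ?_ (by simp) (fun a b ha hb => add_mem ha hb) (fun c a ha => ?_) hb
        · intro l hl
          simp only [List.map_const', List.sum_replicate, smul_eq_mul, mul_one] at hl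
          by_cases hL : l.length ≤ L
          · exact Submodule.subset_span ⟨l, hL, rfl⟩
          obtain ⟨j, hj⟩ := exists_count_ge (not_le.1 hL)
          obtain ⟨l', hl'⟩ := (List.replicate_sublist_iff.2 hj).exists_perm_append
          have hlen : l.length = p + l'.length := by simpa using hl'.length_eq
          have h1 : (l.map x).prod - x j ^ p * (l'.map x).prod ∈ lengthFil F x l.length := by
            simpa using perm_sub_mem h.commutator_mem hl'
          have h2 : (z j - x j ^ p) * (l'.map x).prod ∈ lengthFil F x l.length :=
            mul_mem_wordFil (by omega) (hzx j) (word_mem_lengthFil l' (Nat.lt_succ_self _))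
          have h3 : (l'.map x).prod ∈ lengthFil F x l.length :=
            word_mem_lengthFil l' (by omega)
          have h4 : lengthFil F x l.length ≤ lengthFil F x n := wordFil_mono (by omega)
          have h5 : (l.map x).prod = ((l.map x).prod - x j ^ p * (l'.map x).prod) -
              (z j - x j ^ p) * (l'.map x).prod + (X j : MvPolynomial ι F) • (l'.map x).prod := by
            rw [hsmul, show τ (X j) = z j from centralAeval_X hz j]
            noncomm_ring
          rw [h5]
          exact add_mem (sub_mem (ih _ (h4 h1)) (ih _ (h4 h2)))
            (Submodule.smul_mem _ _ (ih _ (h4 h3)))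
        · have : c • a = (C c : MvPolynomial ι F) • a := by
            rw [hsmul, ← algebraMap_eq, AlgHom.commutes, Algebra.smul_def]
          rw [this]
          exact Submodule.smul_mem _ _ ha
    have hfin : Module.Finite (MvPolynomial ι F) B := by
      refine ⟨⟨hS.toFinset, ?_⟩⟩
      rw [Set.Finite.coe_toFinset, eq_top_iff]
      intro b _
      obtain ⟨n, hn⟩ := exists_mem_wordFil (w := fun _ => 1) h.adjoin_eq_top b
      exact key n b hn
    intro b
    exact IsIntegral.of_finite (MvPolynomial ι F) b

end CentralPoly

/-! ### Division rings of fractions of centrally integral algebras -/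

section Fractions

variable {F ι B D : Type} [Field F] [Ring B] [Algebra F B] [DivisionRing D] [Algebra F D]
  {τ : MvPolynomial ι F →ₐ[F] B}

/-- An element not killed by a homomorphism to a domain has a central left multiple not killed by
it. -/
lemma IsCentralPoly.exists_mul_eq {A : Type} [Ring A] [IsDomain A] [Algebra F A]
    (h : IsCentralPoly τ) (φ : B →ₐ[F] A) (b : B) (hb : φ b ≠ 0) :
    ∃ (b' : B) (P : MvPolynomial ι F), φ (b' * b) = φ (τ P) ∧ φ (τ P) ≠ 0 := by
  obtain ⟨f, hf, hfb⟩ := h.integral b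
  have key : ∀ n, ∀ f : Polynomial (MvPolynomial ι F), f.Monic → f.natDegree = n →
      φ (f.eval₂ (τ : MvPolynomial ι F →+* B) b) = 0 →
      ∃ (b' : B) (P : MvPolynomial ι F), φ (b' * b) = φ (τ P) ∧ φ (τ P) ≠ 0 := by
    intro n
    induction n with
    | zero =>
      intro f hf hd h0
      rw [Polynomial.eq_one_of_monic_natDegree_zero hf hd] at h0
      simp at h0
    | succ n ih =>
      intro f hf hd h0
      rw [← Polynomial.divX_mul_X_add f, Polynomial.eval₂_add, Polynomial.eval₂_mul_X,
        Polynomial.eval₂_C, map_add] at h0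
      by_cases hc : φ (τ (f.coeff 0)) = 0
      · simp only [RingHom.coe_coe, hc, add_zero, map_mul, mul_eq_zero, hb, or_false] at h0
        refine ih f.divX ?_ (by simp [Polynomial.natDegree_divX_eq_natDegree_tsub_one, hd]) h0
        rw [Polynomial.Monic, Polynomial.leadingCoeff,
          Polynomial.natDegree_divX_eq_natDegree_tsub_one, Polynomial.coeff_divX, hd]
        simpa [Polynomial.Monic, Polynomial.leadingCoeff, hd] using hf
      · refine ⟨-f.divX.eval₂ (τ : MvPolynomial ι F →+* B) b, f.coeff 0, ?_, hc⟩
        rw [neg_mul, map_neg]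
        exact neg_eq_of_add_eq_zero_right h0
  exact key _ f hf rfl (by simpa using congrArg φ hfb)

open nonZeroDivisors in
/-- A domain integral over a central polynomial subalgebra has a division ring of fractions. -/
lemma IsCentralPoly.exists_isFractionDivisionRing [IsDomain B] (h : IsCentralPoly τ) :
    ∃ (D : Type) (_ : DivisionRing D) (_ : Algebra F D) (f : B →ₐ[F] D),
      IsFractionDivisionRing F f := by
  have hore : Nonempty (OreLocalization.OreSet B⁰) := by
    rw [OreLocalization.nonempty_oreSet_iff_of_noZeroDivisors]
    intro r s
    obtain ⟨b', P, hP, hP0⟩ := h.exists_mul_eq (AlgHom.id F B) s (nonZeroDivisors.ne_zero s.2)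
    refine ⟨r * b', ⟨τ P, mem_nonZeroDivisors_of_ne_zero hP0⟩, ?_⟩
    simp only [AlgHom.id_apply] at hP
    rw [mul_assoc, hP, h.comm]
  obtain ⟨_⟩ := hore
  refine ⟨OreLocalization B⁰ B, inferInstance, inferInstance,
    { (OreLocalization.numeratorRingHom : B →+* OreLocalization B⁰ B) with
      commutes' := fun c => rfl }, ?_, ?_⟩
  · exact OreLocalization.numeratorHom_inj inf_le_left
  · intro d
    induction d with | _ r s
    refine ⟨r, s, nonZeroDivisors.ne_zero s.2, ?_⟩
    change OreLocalization.oreDiv (s : B) (1 : B⁰) * OreLocalization.oreDiv r s =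
      OreLocalization.oreDiv r (1 : B⁰)
    exact OreLocalization.mul_cancel

/-- Every generator `f' (x' j)` is a left fraction of elements of the image of `φ`. -/
def GeneratesFractions {F B D ι' B' : Type} [Field F] [Ring B] [Algebra F B] [DivisionRing D]
    [Algebra F D] [Ring B'] [Algebra F B'] (φ : B →ₐ[F] D) (f' : B' →ₐ[F] D) (x' : ι' → B') :
    Prop :=
  ∀ j, ∃ a b : B, φ b ≠ 0 ∧ φ b * f' (x' j) = φ a

variable {ι' B' : Type} [Ring B'] [Algebra F B'] {x' : ι' → B'} {f' : B' →ₐ[F] D}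
  {τ' : MvPolynomial ι' F →ₐ[F] B'}

lemma IsCentralPoly.exists_fraction (h : IsCentralPoly τ) {φ : B →ₐ[F] D}
    (hgen : GeneratesFractions φ f' x') (hx' : Algebra.adjoin F (Set.range x') = ⊤)
    (hf' : IsFractionDivisionRing F f') (d : D) :
    ∃ (a : B) (P : MvPolynomial ι F), φ (τ P) ≠ 0 ∧ φ (τ P) * d = φ a := by
  have hc : ∀ P b, φ (τ P) * φ b = φ b * φ (τ P) := fun P b => by
    rw [← map_mul, h.comm, map_mul]
  have hc' : ∀ P (d : D) (Q) (a : B), φ (τ Q) ≠ 0 → φ (τ Q) * d = φ a →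
      φ (τ P) * d = d * φ (τ P) := by
    intro P d Q a hQ hd
    apply mul_left_cancel₀ hQ
    rw [← mul_assoc, hc Q, mul_assoc, hd, ← mul_assoc, hd, hc]
  have hdiv : ∀ (a b : B) (d : D), φ b ≠ 0 → φ b * d = φ a →
      ∃ (a : B) (P : MvPolynomial ι F), φ (τ P) ≠ 0 ∧ φ (τ P) * d = φ a := by
    intro a b d hb hd
    obtain ⟨b', P, hP, hP0⟩ := h.exists_mul_eq φ b hb
    exact ⟨b' * a, P, hP0, by rw [← hP, map_mul, mul_assoc, hd, map_mul]⟩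
  have hB' : ∀ b' : B', ∃ (a : B) (P : MvPolynomial ι F), φ (τ P) ≠ 0 ∧
      φ (τ P) * f' b' = φ a := by
    intro b'
    have hb' : b' ∈ Algebra.adjoin F (Set.range x') := hx' ▸ Algebra.mem_top
    induction hb' using Algebra.adjoin_induction with
    | mem b' hb' =>
      obtain ⟨j, rfl⟩ := hb'
      obtain ⟨a, b, hb, hab⟩ := hgen j
      exact hdiv a b _ hb hab
    | algebraMap c => exact ⟨algebraMap F B c, 1, by simp, by simp⟩
    | add s t _ _ hs ht =>
      obtain ⟨a, P, hP, ha⟩ := hs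
      obtain ⟨b, Q, hQ, hb⟩ := ht
      refine ⟨τ Q * a + τ P * b, Q * P, by simp [hP, hQ], ?_⟩
      rw [map_add, map_mul, map_mul, mul_add, map_add, map_mul, map_mul, ← ha, ← hb,
        ← mul_assoc, ← mul_assoc, hc P]
    | mul s t _ _ hs ht =>
      obtain ⟨a, P, hP, ha⟩ := hs
      obtain ⟨b, Q, hQ, hb⟩ := ht
      refine ⟨a * b, P * Q, by simp [hP, hQ], ?_⟩
      rw [map_mul, map_mul, map_mul, map_mul, ← ha, ← hb, mul_assoc, ← mul_assoc (φ (τ Q)),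
        hc' Q _ P a hP ha]
      simp only [mul_assoc]
  obtain ⟨a', b', hb', hd⟩ := hf'.2 d
  obtain ⟨a, P, hP, ha⟩ := hB' a'
  obtain ⟨b, Q, hQ, hb⟩ := hB' b'
  have hfb : f' b' ≠ 0 := fun h0 => hb' (hf'.1 (by rw [h0, map_zero]))
  refine hdiv (τ Q * a) (τ P * b) d ?_ ?_
  · rw [map_mul, ← hb]
    exact mul_ne_zero hP (mul_ne_zero hQ hfb)
  · rw [map_mul, map_mul, ← ha, ← hb, mul_assoc, mul_assoc, hd, ← mul_assoc, ← mul_assoc,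
      ← map_mul, ← map_mul, ← map_mul, ← map_mul, mul_comm P Q]

lemma IsCentralPoly.map_mem_center (h : IsCentralPoly τ) {φ : B →ₐ[F] D}
    (hfrac : ∀ d : D, ∃ (a : B) (P : MvPolynomial ι F), φ (τ P) ≠ 0 ∧ φ (τ P) * d = φ a)
    (P : MvPolynomial ι F) : φ (τ P) ∈ Subalgebra.center F D := by
  rw [Subalgebra.mem_center_iff]
  intro d
  obtain ⟨a, Q, hQ, hd⟩ := hfrac d
  have hc : ∀ P b, φ (τ P) * φ b = φ b * φ (τ P) := fun P b => by
    rw [← map_mul, h.comm, map_mul]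
  apply mul_left_cancel₀ hQ
  rw [← mul_assoc, hd, ← mul_assoc, hc Q, mul_assoc, hd, hc]

/-- Comparison of the numbers of variables of two polynomial subalgebras of a commutative domain,
when every element is a fraction of integral elements over the first. -/
lemma card_le_of_integral_fractions {F ι ι' C : Type} [Field F] [CommRing C] [IsDomain C]
    [Algebra F C] [Finite ι] [Finite ι'] (t : MvPolynomial ι F →ₐ[F] C)
    (t' : MvPolynomial ι' F →ₐ[F] C) (ht' : Function.Injective t')
    (h : ∀ c, ∃ P, t P ≠ 0 ∧ (t : MvPolynomial ι F →+* C).IsIntegralElem (t P * c)) :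
    Nat.card ι' ≤ Nat.card ι ∧ (Nat.card ι' = Nat.card ι → Function.Injective t) := by
  have ht'' : AlgebraicIndependent F (fun j => t' (X j)) := by
    have : (aeval fun j => t' (X j)) = t' := by ext; simp
    rw [AlgebraicIndependent, this]
    exact ht'
  have hta : aeval (fun j => t (X j)) = t := by ext; simp
  have hadj : Algebra.adjoin F (Set.range fun j => t (X j)) = t.range := by
    rw [Algebra.adjoin_range_eq_range_aeval, hta]
  have halg : Algebra.IsAlgebraic (Algebra.adjoin F (Set.range fun j => t (X j))) C := by
    rw [hadj]
    refine ⟨fun c => ?_⟩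
    obtain ⟨P, hP, f, hf, hfa⟩ := h c
    refine IsAlgebraic.of_mul (mem_nonZeroDivisors_of_ne_zero hP) ?_ ?_
    · exact isAlgebraic_algebraMap (⟨t P, P, rfl⟩ : t.range)
    · apply IsIntegral.isAlgebraic
      refine ⟨f.map (t.rangeRestrict : MvPolynomial ι F →+* t.range), hf.map _, ?_⟩
      rw [Polynomial.eval₂_map]
      exact hfa
  have hle := Algebra.IsAlgebraic.trdeg_le_cardinalMk F (Set.range fun j => t (X j))
  have hge := ht''.cardinalMk_le_trdeg
  have := Fintype.ofFinite ι
  have := Fintype.ofFinite ι'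
  refine ⟨?_, fun hcard => ?_⟩
  · have := (hge.trans hle).trans Cardinal.mk_range_le
    simpa using this
  · have hb : IsTranscendenceBasis F (fun j => t (X j)) := by
      refine Algebra.IsAlgebraic.isTranscendenceBasis_of_le_trdeg_of_finite F _ (le_trans ?_ hge)
      simp only [Nat.card_eq_fintype_card] at hcard
      simp [hcard]
    have hinj := hb.1
    rwa [AlgebraicIndependent, hta] at hinj

/-- Comparison of the numbers of central variables. -/
lemma IsCentralPoly.card_le [Finite ι] [Finite ι'] (h : IsCentralPoly τ) (h' : IsCentralPoly τ')
    {φ : B →ₐ[F] D} (hgen : GeneratesFractions φ f' x')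
    (hx' : Algebra.adjoin F (Set.range x') = ⊤) (hf' : IsFractionDivisionRing F f') :
    Nat.card ι' ≤ Nat.card ι ∧
      (Nat.card ι' = Nat.card ι → Function.Injective (φ.comp τ)) := by
  have hfrac := h.exists_fraction hgen hx' hf'
  have hcen := h.map_mem_center hfrac
  let C := Subalgebra.center F D
  have : IsDomain C := inferInstance
  have hcen' : ∀ P, f' (τ' P) ∈ C := by
    refine h'.map_mem_center (φ := f') fun d => ?_
    obtain ⟨a, b, hb, hd⟩ := hf'.2 d
    have hfb : f' b ≠ 0 := fun h0 => hb (hf'.1 (by rw [h0, map_zero]))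
    obtain ⟨b', P, hP, hP0⟩ := h'.exists_mul_eq f' b hfb
    exact ⟨b' * a, P, hP0, by rw [← hP, map_mul, mul_assoc, hd, map_mul]⟩
  let t : MvPolynomial ι F →ₐ[F] C := (φ.comp τ).codRestrict C hcen
  let t' : MvPolynomial ι' F →ₐ[F] C := (f'.comp τ').codRestrict C hcen'
  have ht' : Function.Injective t' := fun P Q hPQ =>
    h'.injective (hf'.1 (congrArg Subtype.val hPQ))
  obtain ⟨h1, h2⟩ := card_le_of_integral_fractions t t' ht' fun c => by
    obtain ⟨a, P, hP, hd⟩ := hfrac c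
    refine ⟨P, fun h0 => hP (congrArg Subtype.val h0), ?_⟩
    obtain ⟨f, hf, hfa⟩ := h.integral a
    refine ⟨f, hf, Subtype.val_injective ?_⟩
    have h1 := Polynomial.hom_eval₂ f (t : MvPolynomial ι F →+* C) (C.val : C →+* D) (t P * c)
    have h2 := Polynomial.hom_eval₂ f (τ : MvPolynomial ι F →+* B) (φ : B →+* D) a
    rw [hfa, map_zero] at h2
    refine h1.trans (Eq.trans ?_ h2.symm)
    have h3 : (C.val : C →+* D) (t P * c) = (φ : B →+* D) a := hd
    rw [h3]
    rfl
  refine ⟨h1, fun hcard P Q hPQ => h2 hcard (Subtype.ext hPQ)⟩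

/-- A generating homomorphism between centrally integral domains with the same number of central
variables identifies the division rings of fractions. -/
lemma IsCentralPoly.isFractionDivisionRing [Finite ι] [Finite ι'] [IsDomain B]
    (h : IsCentralPoly τ) (h' : IsCentralPoly τ')
    {φ : B →ₐ[F] D} (hgen : GeneratesFractions φ f' x')
    (hx' : Algebra.adjoin F (Set.range x') = ⊤) (hf' : IsFractionDivisionRing F f')
    (hcard : Nat.card ι' = Nat.card ι) : IsFractionDivisionRing F φ := by
  have hinj := (h.card_le h' hgen hx' hf').2 hcard
  refine ⟨?_, fun d => ?_⟩
  · rw [injective_iff_map_eq_zero]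
    intro b hb
    by_contra hne
    obtain ⟨b', P, hP, hP0⟩ := h.exists_mul_eq (AlgHom.id F B) b hne
    refine hP0 ?_
    have : P = 0 := hinj (by
      simp only [AlgHom.id_apply] at hP
      rw [AlgHom.comp_apply, ← hP, map_mul, hb, mul_zero, map_zero])
    simp [this]
  · obtain ⟨a, P, hP, hd⟩ := h.exists_fraction hgen hx' hf' d
    exact ⟨a, τ P, fun h0 => hP (by rw [h0, map_zero]), hd⟩

end Fractions

/-! ### Extension to division rings of fractions -/

section Extension

open nonZeroDivisors

/-- A homomorphism inverting all nonzero elements extends to the division ring of fractions. -/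
lemma IsFractionDivisionRing.exists_extension {F B D E : Type} [Field F] [Ring B] [Algebra F B]
    [DivisionRing D] [Algebra F D] [Ring E] [Algebra F E] {f : B →ₐ[F] D}
    (hf : IsFractionDivisionRing F f) (Ψ : B →ₐ[F] E) (hΨ : ∀ b, b ≠ 0 → IsUnit (Ψ b)) :
    ∃ Φ : D →ₐ[F] E, ∀ b, Φ (f b) = Ψ b := by
  have : IsDomain B := hf.1.isDomain (f : B →+* D)
  have hne : ∀ b, b ≠ 0 → f b ≠ 0 := fun b hb h0 => hb (hf.1 (by rw [h0, map_zero]))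
  have hore : Nonempty (OreLocalization.OreSet B⁰) := by
    rw [OreLocalization.nonempty_oreSet_iff_of_noZeroDivisors]
    intro r s
    have hs := hne s (nonZeroDivisors.ne_zero s.2)
    obtain ⟨a, b, hb, hd⟩ := hf.2 (f r * (f s)⁻¹)
    refine ⟨a, ⟨b, mem_nonZeroDivisors_of_ne_zero hb⟩, hf.1 ?_⟩
    rw [map_mul, map_mul, ← hd, mul_assoc, mul_assoc, inv_mul_cancel₀ hs, mul_one]
  obtain ⟨_⟩ := hore
  have huD : ∀ s : B⁰, IsUnit (((f : B →* D).comp B⁰.subtype) s) := fun s =>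
    (hne s (nonZeroDivisors.ne_zero s.2)).isUnit
  have huE : ∀ s : B⁰, IsUnit (((Ψ : B →* E).comp B⁰.subtype) s) := fun s =>
    hΨ s (nonZeroDivisors.ne_zero s.2)
  let iD : OreLocalization B⁰ B →+* D :=
    OreLocalization.universalHom (f : B →+* D) (IsUnit.liftRight _ huD) fun s => rfl
  let iE : OreLocalization B⁰ B →+* E :=
    OreLocalization.universalHom (Ψ : B →+* E) (IsUnit.liftRight _ huE) fun s => rfl
  have hiD : ∀ b, iD (OreLocalization.numeratorHom b) = f b := fun b =>
    OreLocalization.universalHom_commutes _ _ fun s => rfl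
  have hiE : ∀ b, iE (OreLocalization.numeratorHom b) = Ψ b := fun b =>
    OreLocalization.universalHom_commutes _ _ fun s => rfl
  have hbij : Function.Bijective iD := by
    refine ⟨iD.injective, fun d => ?_⟩
    obtain ⟨a, b, hb, hd⟩ := hf.2 d
    refine ⟨(OreLocalization.numeratorHom b)⁻¹ * OreLocalization.numeratorHom a, ?_⟩
    rw [map_mul, map_inv₀, hiD, hiD, ← hd, inv_mul_cancel_left₀ (hne b hb)]
  let e := RingEquiv.ofBijective iD hbij
  have he : ∀ b, e.symm (f b) = OreLocalization.numeratorHom b := fun b => by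
    rw [RingEquiv.symm_apply_eq]
    exact (hiD b).symm
  refine ⟨{ iE.comp (e.symm : D →+* OreLocalization B⁰ B) with
    commutes' := fun c => ?_ }, fun b => ?_⟩
  · change iE (e.symm (algebraMap F D c)) = _
    rw [← f.commutes, he, hiE, Ψ.commutes]
  · change iE (e.symm (f b)) = _
    rw [he, hiE]

end Extension

/-! ### Germs of families of rings along a filter -/

section Germs

open Filter

variable {I : Type} {l : Filter I}

/-- Two families are congruent when they agree eventually. -/
def germCon (l : Filter I) (A : I → Type) [∀ i, Ring (A i)] : RingCon (∀ i, A i) where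
  r f g := ∀ᶠ i in l, f i = g i
  iseqv := ⟨fun _ => Eventually.of_forall fun _ => rfl, fun h => h.mono fun _ h => h.symm,
    fun h h' => (h.and h').mono fun _ h => h.1.trans h.2⟩
  mul' h h' := (h.and h').mono fun _ h => by simp [h.1, h.2]
  add' h h' := (h.and h').mono fun _ h => by simp [h.1, h.2]

/-- The ring of germs of a family of rings along a filter. -/
abbrev RingGerm (l : Filter I) (A : I → Type) [∀ i, Ring (A i)] : Type := (germCon l A).Quotient

/-- The germ of a family. -/
abbrev germMk (l : Filter I) (A : I → Type) [∀ i, Ring (A i)] : (∀ i, A i) →+* RingGerm l A :=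
  (germCon l A).mk'

lemma germMk_eq {A : I → Type} [∀ i, Ring (A i)] {f g : ∀ i, A i} :
    germMk l A f = germMk l A g ↔ ∀ᶠ i in l, f i = g i :=
  RingCon.eq _

lemma germMk_surjective (A : I → Type) [∀ i, Ring (A i)] : Function.Surjective (germMk l A) :=
  RingCon.mk'_surjective _

/-- The homomorphism on germs induced by a family of homomorphisms. -/
def germMap (l : Filter I) {A B : I → Type} [∀ i, Ring (A i)] [∀ i, Ring (B i)]
    (f : ∀ i, A i →+* B i) : RingGerm l A →+* RingGerm l B :=
  RingCon.lift (germCon l A) ((germMk l B).comp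
    (RingHom.pi fun i => (f i).comp (Pi.evalRingHom A i))) fun _ _ h =>
    germMk_eq.2 (h.mono fun i hi => congrArg (f i) hi)

lemma germMap_mk {A B : I → Type} [∀ i, Ring (A i)] [∀ i, Ring (B i)] (f : ∀ i, A i →+* B i)
    (a : ∀ i, A i) : germMap l f (germMk l A a) = germMk l B fun i => f i (a i) :=
  rfl

/-- The maps `θ i` form an injective homomorphism to the germs. -/
structure IsGermEmbedding {K : Type} [Field K] (l : Filter I) {k : I → Type} [∀ i, Field (k i)]
    (θ : ∀ i, K → k i) : Prop where
  one : ∀ᶠ i in l, θ i 1 = 1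
  mul : ∀ a b, ∀ᶠ i in l, θ i (a * b) = θ i a * θ i b
  add : ∀ a b, ∀ᶠ i in l, θ i (a + b) = θ i a + θ i b
  ne_zero : ∀ a, a ≠ 0 → ∀ᶠ i in l, θ i a ≠ 0

variable {K : Type} [Field K] {k : I → Type} [∀ i, Field (k i)] {θ : ∀ i, K → k i}

/-- The homomorphism to germs defined by `θ`. -/
def IsGermEmbedding.hom (hθ : IsGermEmbedding l θ) : K →+* RingGerm l k :=
  RingHom.mk' ⟨⟨fun c => germMk l k fun i => θ i c, germMk_eq.2 hθ.one⟩,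
    fun a b => germMk_eq.2 (hθ.mul a b)⟩ fun a b => germMk_eq.2 (hθ.add a b)

/-- The algebra structure on germs of algebras. -/
abbrev IsGermEmbedding.algebra (hθ : IsGermEmbedding l θ) (A : I → Type) [∀ i, Ring (A i)]
    [∀ i, Algebra (k i) (A i)] : Algebra K (RingGerm l A) :=
  ((germMap l fun i => algebraMap (k i) (A i)).comp hθ.hom).toAlgebra' fun c a => by
    obtain ⟨a, rfl⟩ := germMk_surjective A a
    exact germMk_eq.2 (Eventually.of_forall fun i => Algebra.commutes (θ i c) (a i))

lemma IsGermEmbedding.algebraMap_apply (hθ : IsGermEmbedding l θ) (A : I → Type)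
    [∀ i, Ring (A i)] [∀ i, Algebra (k i) (A i)] (c : K) :
    let _ := hθ.algebra A
    algebraMap K (RingGerm l A) c = germMk l A fun i => algebraMap (k i) (A i) (θ i c) :=
  rfl

lemma lift_int_map {ι A B : Type} [Ring A] [Ring B] (φ : A →+* B) (x : ι → A)
    (w : FreeAlgebra ℤ ι) :
    φ (FreeAlgebra.lift ℤ x w) = FreeAlgebra.lift ℤ (fun j => φ (x j)) w := by
  have : φ.toIntAlgHom.comp (FreeAlgebra.lift ℤ x) = FreeAlgebra.lift ℤ (fun j => φ (x j)) := by
    ext j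
    simp
  exact DFunLike.congr_fun this w

end Germs

/-! ### Algebras with integral presentations -/

/-- The `F`-algebra `B` is generated by `x` with the integral relations `R`. -/
structure IsPresented (F : Type) {ι B : Type} [Field F] [Ring B] [Algebra F B]
    (R : Finset (FreeAlgebra ℤ ι)) (x : ι → B) : Prop where
  rel : ∀ w ∈ R, FreeAlgebra.lift ℤ x w = 0
  exists_lift : ∀ (E : Type) [Ring E] [Algebra F E] (e : ι → E),
    (∀ w ∈ R, FreeAlgebra.lift ℤ e w = 0) → ∃ φ : B →ₐ[F] E, ∀ j, φ (x j) = e j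

section Transfer

open Filter

variable {I : Type} {l : Filter I} {K : Type} [Field K] {k : I → Type} [∀ i, Field (k i)]
  {θ : ∀ i, K → k i}

lemma exists_hom_germ {ι B : Type} [Ring B] [Algebra K B] {x : ι → B} {Bi : I → Type}
    [∀ i, Ring (Bi i)] [∀ i, Algebra (k i) (Bi i)] {xi : ∀ i, ι → Bi i}
    {R : Finset (FreeAlgebra ℤ ι)} (hθ : IsGermEmbedding l θ) (hB : IsPresented K R x)
    (hx : HasPBW K x) (hBi : ∀ i, IsPresented (k i) R (xi i)) (hxi : ∀ i, HasPBW (k i) (xi i)) :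
    let _ := hθ.algebra Bi
    ∃ T : B →ₐ[K] RingGerm l Bi, (∀ j, T (x j) = germMk l Bi fun i => xi i j) ∧
      ∀ b, b ≠ 0 → ∃ g : ∀ i, Bi i, T b = germMk l Bi g ∧ ∀ᶠ i in l, g i ≠ 0 := by
  let := hθ.algebra Bi
  obtain ⟨T, hT⟩ := hB.exists_lift (RingGerm l Bi) (fun j => germMk l Bi fun i => xi i j) <| by
    intro w hw
    rw [← lift_int_map (germMk l Bi) (fun j i => xi i j) w, ← map_zero (germMk l Bi)]
    congr 1
    funext i
    exact (lift_int_map (Pi.evalRingHom Bi i) _ w).trans ((hBi i).rel w hw)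
  refine ⟨T, hT, fun b hb => ?_⟩
  obtain ⟨P, rfl⟩ := hx.wordMap_surjective b
  have hword : ∀ L : List ι, T (L.map x).prod = germMk l Bi fun i => (L.map (xi i)).prod := by
    intro L
    induction L with
    | nil => simp only [List.map_nil, List.prod_nil, map_one]; rfl
    | cons j L ih =>
      simp only [List.map_cons, List.prod_cons, map_mul, hT, ih]
      rfl
  refine ⟨fun i => wordMap (k i) (xi i) (∑ s ∈ P.support, monomial s (θ i (P.coeff s))), ?_, ?_⟩
  · conv_lhs => rw [P.as_sum, map_sum, map_sum]
    have : (fun i => wordMap (k i) (xi i) (∑ s ∈ P.support, monomial s (θ i (P.coeff s)))) =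
        ∑ s ∈ P.support, fun i => wordMap (k i) (xi i) (monomial s (θ i (P.coeff s))) := by
      funext i
      simp
    rw [this, map_sum]
    refine Finset.sum_congr rfl fun s _ => ?_
    simp only [wordMap_monomial]
    rw [map_smul, hword, Algebra.smul_def, hθ.algebraMap_apply, ← map_mul]
    refine congrArg _ (funext fun i => ?_)
    simp [Algebra.smul_def]
  · have hP : P ≠ 0 := by
      rintro rfl
      simp at hb
    obtain ⟨s, hs⟩ := MvPolynomial.ne_zero_iff.1 hP
    filter_upwards [hθ.ne_zero _ hs] with i hi h0
    have h1 := (hxi i).wordMap_injective (h0.trans (map_zero _).symm)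
    have h2 := congrArg (coeff s) h1
    classical
    simp only [coeff_sum, coeff_monomial, Finset.sum_ite_eq', coeff_zero] at h2
    rw [if_pos (mem_support_iff.2 hs)] at h2
    exact hi h2

/-- If two presented algebras share a division ring of fractions, then eventually the
specializations of the first one map to the division rings of fractions of the specializations of
the second one, with generating image. -/
lemma eventually_exists_generatesFractions {ι ι' B B' D : Type} [Finite ι'] [Ring B] [Algebra K B]
    [Ring B'] [Algebra K B'] [DivisionRing D] [Algebra K D] {x : ι → B} {x' : ι' → B'}
    {R : Finset (FreeAlgebra ℤ ι)} {R' : Finset (FreeAlgebra ℤ ι')}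
    {Bi Bi' Di : I → Type} [∀ i, Ring (Bi i)] [∀ i, Algebra (k i) (Bi i)]
    [∀ i, Ring (Bi' i)] [∀ i, Algebra (k i) (Bi' i)] [∀ i, DivisionRing (Di i)]
    [∀ i, Algebra (k i) (Di i)] {xi : ∀ i, ι → Bi i} {xi' : ∀ i, ι' → Bi' i}
    (hθ : IsGermEmbedding l θ) (hB : IsPresented K R x) (hx : HasPBW K x)
    (hBi : ∀ i, IsPresented (k i) R (xi i))
    (hB' : IsPresented K R' x') (hx' : HasPBW K x')
    (hBi' : ∀ i, IsPresented (k i) R' (xi' i)) (hxi' : ∀ i, HasPBW (k i) (xi' i))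
    {f : B →ₐ[K] D} {f' : B' →ₐ[K] D} (hf : IsFractionDivisionRing K f)
    (hf' : IsFractionDivisionRing K f') {fi' : ∀ i, Bi' i →ₐ[k i] Di i}
    (hfi' : ∀ i, IsFractionDivisionRing (k i) (fi' i)) :
    ∀ᶠ i in l, ∃ φ : Bi i →ₐ[k i] Di i, GeneratesFractions φ (fi' i) (xi' i) := by
  let := hθ.algebra Bi'
  let := hθ.algebra Di
  obtain ⟨T, hT, hT0⟩ := exists_hom_germ hθ hB' hx' hBi' hxi'
  let Ψ : B' →ₐ[K] RingGerm l Di :=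
    { (germMap l fun i => (fi' i : Bi' i →+* Di i)).comp (T : B' →+* RingGerm l Bi') with
      commutes' := fun c => by
        change germMap l (fun i => (fi' i : Bi' i →+* Di i)) (T (algebraMap K B' c)) = _
        rw [T.commutes, hθ.algebraMap_apply, germMap_mk, hθ.algebraMap_apply]
        simp }
  have hΨ : ∀ b g, T b = germMk l Bi' g → Ψ b = germMk l Di fun i => fi' i (g i) := by
    intro b g hg
    change germMap l _ (T b) = _
    rw [hg]
    rfl
  obtain ⟨Φ, hΦ⟩ := hf'.exists_extension Ψ <| by
    intro b hb
    obtain ⟨g, hg, hg0⟩ := hT0 b hb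
    rw [hΨ b g hg]
    refine isUnit_iff_exists.2 ⟨germMk l Di fun i => (fi' i (g i))⁻¹, ?_, ?_⟩ <;>
    · rw [← map_mul, ← map_one (germMk l Di), germMk_eq]
      filter_upwards [hg0] with i hi
      have : fi' i (g i) ≠ 0 := fun h0 => hi ((hfi' i).1 (by rw [h0, map_zero]))
      simp [this]
  let Θ : B →ₐ[K] RingGerm l Di := Φ.comp f
  choose y hy using fun j => germMk_surjective Di (Θ (x j))
  have hrel : ∀ᶠ i in l, ∀ w ∈ R, FreeAlgebra.lift ℤ (fun j => y j i) w = 0 := by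
    rw [eventually_all_finset]
    intro w hw
    have h1 := congrArg Θ (hB.rel w hw)
    rw [map_zero] at h1
    have h2 := lift_int_map (Θ : B →+* RingGerm l Di) x w
    have h3 := lift_int_map (germMk l Di) y w
    simp only [RingHom.coe_coe, ← hy] at h2
    rw [h1, ← h3, ← map_zero (germMk l Di), germMk_eq] at h2
    filter_upwards [h2] with i hi
    exact (lift_int_map (Pi.evalRingHom Di i) y w).symm.trans hi.symm
  have key : ∀ b : B, ∃ (g : ∀ i, Bi i) (h : ∀ i, Di i), Θ b = germMk l Di h ∧
      ∀ᶠ i in l, ∀ φ : Bi i →ₐ[k i] Di i, (∀ j, φ (xi i j) = y j i) → φ (g i) = h i := by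
    intro b
    have hb : b ∈ Algebra.adjoin K (Set.range x) := hx.adjoin_eq_top ▸ Algebra.mem_top
    induction hb using Algebra.adjoin_induction with
    | mem b hb =>
      obtain ⟨j, rfl⟩ := hb
      exact ⟨fun i => xi i j, y j, (hy j).symm, Eventually.of_forall fun i φ hφ => hφ j⟩
    | algebraMap c =>
      refine ⟨fun i => algebraMap (k i) (Bi i) (θ i c), fun i => algebraMap (k i) (Di i) (θ i c),
        ?_, Eventually.of_forall fun i φ _ => φ.commutes _⟩
      rw [Θ.commutes, hθ.algebraMap_apply]
    | add a b _ _ ha hb =>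
      obtain ⟨g, h, hh, he⟩ := ha
      obtain ⟨g', h', hh', he'⟩ := hb
      refine ⟨g + g', h + h', by rw [map_add, map_add, hh, hh'], ?_⟩
      filter_upwards [he, he'] with i hi hi' φ hφ
      simp [hi φ hφ, hi' φ hφ]
    | mul a b _ _ ha hb =>
      obtain ⟨g, h, hh, he⟩ := ha
      obtain ⟨g', h', hh', he'⟩ := hb
      refine ⟨g * g', h * h', by rw [map_mul, map_mul, hh, hh'], ?_⟩
      filter_upwards [he, he'] with i hi hi' φ hφ
      simp [hi φ hφ, hi' φ hφ]
  have hgen : ∀ j, ∀ᶠ i in l, ∃ a b : Bi i, ∀ φ : Bi i →ₐ[k i] Di i,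
      (∀ j, φ (xi i j) = y j i) → φ b ≠ 0 ∧ φ b * fi' i (xi' i j) = φ a := by
    intro j
    obtain ⟨a, b, hb, hab⟩ := hf.2 (f' (x' j))
    obtain ⟨g, h, hh, he⟩ := key a
    obtain ⟨g', h', hh', he'⟩ := key b
    have hfb : f b ≠ 0 := fun h0 => hb (hf.1 (by rw [h0, map_zero]))
    obtain ⟨v, hv⟩ := germMk_surjective Di (Φ (f b)⁻¹)
    have h1 : ∀ᶠ i in l, h' i * v i = 1 := by
      refine (germMk_eq (f := h' * v) (g := 1)).1 ?_
      rw [map_mul, map_one, hv, ← hh']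
      change Φ (f b) * _ = 1
      rw [← map_mul, mul_inv_cancel₀ hfb, map_one]
    have h2 : ∀ᶠ i in l, h' i * fi' i (xi' i j) = h i := by
      refine (germMk_eq (f := h' * fun i => fi' i (xi' i j)) (g := h)).1 ?_
      rw [map_mul, ← hΨ _ _ (hT j), ← hh, ← hh', ← hΦ]
      change Φ (f b) * _ = Φ (f a)
      rw [← map_mul, hab]
    filter_upwards [he, he', h1, h2] with i hi hi' h1 h2
    refine ⟨g i, g' i, fun φ hφ => ?_⟩
    rw [hi φ hφ, hi' φ hφ]
    exact ⟨left_ne_zero_of_mul_eq_one h1, h2⟩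
  filter_upwards [hrel, eventually_all.2 hgen] with i hi hgi
  obtain ⟨φ, hφ⟩ := (hBi i).exists_lift (Di i) (fun j => y j i) hi
  refine ⟨φ, fun j => ?_⟩
  obtain ⟨a, b, hab⟩ := hgi j
  exact ⟨a, b, hab φ hφ⟩

/-- If two presented algebras share a division ring of fractions, then so do eventually their
specializations. -/
lemma eventually_exists_isFractionDivisionRing {ι ι' B B' D : Type} [Finite ι] [Finite ι']
    [Ring B] [Algebra K B]
    [Ring B'] [Algebra K B'] [DivisionRing D] [Algebra K D] {x : ι → B} {x' : ι' → B'}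
    {R : Finset (FreeAlgebra ℤ ι)} {R' : Finset (FreeAlgebra ℤ ι')}
    {Bi Bi' : I → Type} [∀ i, Ring (Bi i)] [∀ i, Algebra (k i) (Bi i)]
    [∀ i, Ring (Bi' i)] [∀ i, Algebra (k i) (Bi' i)] {xi : ∀ i, ι → Bi i}
    {xi' : ∀ i, ι' → Bi' i} (hθ : IsGermEmbedding l θ)
    (hB : IsPresented K R x) (hx : HasPBW K x)
    (hBi : ∀ i, IsPresented (k i) R (xi i)) (hxi : ∀ i, HasPBW (k i) (xi i))
    (hB' : IsPresented K R' x') (hx' : HasPBW K x')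
    (hBi' : ∀ i, IsPresented (k i) R' (xi' i)) (hxi' : ∀ i, HasPBW (k i) (xi' i))
    {f : B →ₐ[K] D} {f' : B' →ₐ[K] D} (hf : IsFractionDivisionRing K f)
    (hf' : IsFractionDivisionRing K f')
    (hτ : ∀ i, ∃ τ : MvPolynomial ι (k i) →ₐ[k i] Bi i, IsCentralPoly τ)
    (hτ' : ∀ i, ∃ τ : MvPolynomial ι' (k i) →ₐ[k i] Bi' i, IsCentralPoly τ) :
    ∀ᶠ i in l, ∃ (Di : Type) (_ : DivisionRing Di) (_ : Algebra (k i) Di)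
      (φ : Bi i →ₐ[k i] Di) (φ' : Bi' i →ₐ[k i] Di),
      IsFractionDivisionRing (k i) φ ∧ IsFractionDivisionRing (k i) φ' := by
  choose τ hτ using hτ
  choose τ' hτ' using hτ'
  have hdom := fun i => (hxi i).isDomain
  have hdom' := fun i => (hxi' i).isDomain
  choose D₁ div₁ alg₁ f₁ hf₁ using fun i => (hτ i).exists_isFractionDivisionRing
  choose D₂ div₂ alg₂ f₂ hf₂ using fun i => (hτ' i).exists_isFractionDivisionRing
  filter_upwards [eventually_exists_generatesFractions hθ hB hx hBi hB' hx' hBi' hxi' hf hf' hf₂,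
    eventually_exists_generatesFractions hθ hB' hx' hBi' hB hx hBi hxi hf' hf hf₁]
    with i ⟨φ, hφ⟩ ⟨φ', hφ'⟩
  have h1 := ((hτ i).card_le (hτ' i) hφ (hxi' i).adjoin_eq_top (hf₂ i)).1
  have h2 := ((hτ' i).card_le (hτ i) hφ' (hxi i).adjoin_eq_top (hf₁ i)).1
  exact ⟨D₂ i, div₂ i, alg₂ i, φ, f₂ i, (hτ i).isFractionDivisionRing (hτ' i) hφ
    (hxi' i).adjoin_eq_top (hf₂ i) (h1.antisymm h2), hf₂ i⟩

end Transfer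

/-! ### First-order differential operators and symbols -/

section Operators

variable {F κ : Type} [Field F]

/-- The operator `f ↦ D f + ω f`. -/
def derivOp (D : Derivation F (MvPolynomial κ F) (MvPolynomial κ F)) (ω : MvPolynomial κ F) :
    Module.End F (MvPolynomial κ F) :=
  (D : MvPolynomial κ F →ₗ[F] MvPolynomial κ F) + LinearMap.mulLeft F ω

lemma derivOp_apply (D : Derivation F (MvPolynomial κ F) (MvPolynomial κ F))
    (ω f : MvPolynomial κ F) : derivOp D ω f = D f + ω * f :=
  rfl

lemma derivOp_commutator (D D' : Derivation F (MvPolynomial κ F) (MvPolynomial κ F))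
    (ω ω' : MvPolynomial κ F) :
    derivOp D ω * derivOp D' ω' - derivOp D' ω' * derivOp D ω =
      derivOp ⁅D, D'⁆ (D ω' - D' ω) := by
  refine LinearMap.ext fun f => ?_
  simp only [LinearMap.sub_apply, Module.End.mul_apply, derivOp_apply, map_add,
    Derivation.leibniz, smul_eq_mul, Derivation.commutator_apply]
  ring

lemma derivation_mem_wordFil {w : κ → ℕ}
    {D : Derivation F (MvPolynomial κ F) (MvPolynomial κ F)}
    (hD : ∀ s, D (X s) ∈ wordFil F X w (w s + 1)) {n : ℕ} {f : MvPolynomial κ F}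
    (hf : f ∈ wordFil F X w n) : D f ∈ wordFil F X w n := by
  have key : ∀ l : List κ, D (l.map X).prod ∈ wordFil F X w ((l.map w).sum + 1) := by
    intro l
    induction l with
    | nil => simp
    | cons s l ih =>
      simp only [List.map_cons, List.prod_cons, List.sum_cons, Derivation.leibniz, smul_eq_mul]
      refine add_mem (mul_mem_wordFil (by omega) (gen_mem_wordFil s) ih)
        (mul_mem_wordFil (n := w s + 1) (by omega) (word_mem_wordFil l (Nat.lt_succ_self _)) (hD s))
  exact wordFil_induction (P := fun f => D f ∈ wordFil F X w n)
    (fun l hl => wordFil_mono hl (key l)) (by simp)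
    (fun a b ha hb => by simpa using add_mem ha hb)
    (fun c a ha => by simpa using Submodule.smul_mem _ c ha) hf

/-- An action by first-order operators with independent leading terms defines a symbol map. -/
lemma exists_symbol_of_derivOp {ι B : Type} [Ring B] [Algebra F B] {x : ι → B} (w : κ → ℕ)
    (D : ι → Derivation F (MvPolynomial κ F) (MvPolynomial κ F)) (ω : ι → MvPolynomial κ F)
    (ρ : B →ₐ[F] Module.End F (MvPolynomial κ F)) (ev : MvPolynomial κ F →ₐ[F] MvPolynomial ι F)
    (hρ : ∀ j, ρ (x j) = derivOp (D j) (ω j))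
    (hD : ∀ j s, D j (X s) ∈ wordFil F X w (w s + 1)) (hω : ∀ j, ω j ∈ wordFil F X w 2)
    (hev : ∀ s, ev (X s) ∈ lengthFil F (X : ι → MvPolynomial ι F) (w s + 1))
    (hevω : ∀ j, ev (ω j) = X j) :
    ∃ σ : B →ₗ[F] MvPolynomial ι F, ∀ l : List ι,
      σ (l.map x).prod - (l.map X).prod ∈ lengthFil F (X : ι → MvPolynomial ι F) l.length := by
  have hprod : ∀ l : List ι, (l.map ω).prod ∈ wordFil F X w (l.length + 1) := by
    intro l
    induction l with
    | nil => exact one_mem_wordFil one_pos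
    | cons j l ih =>
      simp only [List.map_cons, List.prod_cons, List.length_cons]
      exact mul_mem_wordFil (by omega) (hω j) ih
  have key : ∀ l : List ι, ρ (l.map x).prod 1 - (l.map ω).prod ∈ wordFil F X w l.length := by
    intro l
    induction l with
    | nil => simp
    | cons j l ih =>
      have h1 : ρ ((j :: l).map x).prod 1 - ((j :: l).map ω).prod =
          D j (ρ (l.map x).prod 1) + ω j * (ρ (l.map x).prod 1 - (l.map ω).prod) := by
        simp only [List.map_cons, List.prod_cons, map_mul, hρ, Module.End.mul_apply, derivOp_apply]
        ring
      rw [h1, List.length_cons]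
      refine add_mem (derivation_mem_wordFil (hD j) ?_) (mul_mem_wordFil (by omega) (hω j) ih)
      rw [← sub_add_cancel (ρ (l.map x).prod 1) (l.map ω).prod]
      exact add_mem (wordFil_mono (Nat.le_succ _) ih) (hprod l)
  refine ⟨ev.toLinearMap.comp ((LinearMap.applyₗ 1).comp ρ.toLinearMap), fun l => ?_⟩
  have h2 := map_mem_wordFil ev hev (key l)
  have h3 : ev (l.map ω).prod = (l.map X).prod := by
    rw [map_list_prod, List.map_map]
    congr 1
    exact List.map_congr_left fun j _ => hevω j
  rw [map_sub, h3] at h2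
  exact h2

end Operators

/-! ### Commutation relations -/

section Relations

open Classical in
/-- The relations `x i * x j - x j * x i = q i j`. -/
def commutationRelations {ι : Type} [Fintype ι] (q : ι → ι → FreeAlgebra ℤ ι) :
    Finset (FreeAlgebra ℤ ι) :=
  Finset.univ.image fun ij : ι × ι => FreeAlgebra.ι ℤ ij.1 * FreeAlgebra.ι ℤ ij.2 -
    FreeAlgebra.ι ℤ ij.2 * FreeAlgebra.ι ℤ ij.1 - q ij.1 ij.2

lemma forall_commutationRelations {ι E : Type} [Fintype ι] {q : ι → ι → FreeAlgebra ℤ ι} [Ring E]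
    {e : ι → E} : (∀ w ∈ commutationRelations q, FreeAlgebra.lift ℤ e w = 0) ↔
      ∀ i j, e i * e j - e j * e i = FreeAlgebra.lift ℤ e (q i j) := by
  simp only [commutationRelations, Finset.forall_mem_image, Finset.mem_univ, true_imp_iff, map_sub,
    map_mul, FreeAlgebra.lift_ι_apply, sub_eq_zero, Prod.forall]

end Relations

/-! ### Commutators in positive characteristic -/

section CharP

lemma pow_char_commutator {F A : Type} [Field F] [Ring A] [Algebra F A] (p : ℕ) [Fact p.Prime]
    [CharP F p] (x y : A) : x ^ p * y - y * x ^ p = (fun z => x * z - z * x)^[p] y := by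
  rcases subsingleton_or_nontrivial A with h | h
  · exact Subsingleton.elim _ _
  have := charP_of_injective_algebraMap (algebraMap F (Module.End F A)).injective p
  have h1 := sub_pow_char_of_commute p (LinearMap.commute_mulLeft_right (R := F) x x)
  rw [LinearMap.pow_mulLeft, LinearMap.pow_mulRight] at h1
  have h2 := LinearMap.congr_fun h1 y
  rw [Module.End.pow_apply] at h2
  exact h2.symm

end CharP

/-! ### The algebras `A_{r,s}` -/

section Weyl

variable {r s : ℕ}

open Classical in
instance : Fintype (WeylPolyGen r s) :=
  Fintype.ofSurjective (fun t : Fin r ⊕ Fin r ⊕ Fin s =>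
    Sum.elim WeylPolyGen.u (Sum.elim WeylPolyGen.v WeylPolyGen.y) t) fun g => by
      cases g with
      | u i => exact ⟨Sum.inl i, rfl⟩
      | v i => exact ⟨Sum.inr (Sum.inl i), rfl⟩
      | y k => exact ⟨Sum.inr (Sum.inr k), rfl⟩

/-- The commutators of the generators of `A_{r,s}`. -/
def weylBracket : WeylPolyGen r s → WeylPolyGen r s → ℤ
  | .u i, .v j => if i = j then 1 else 0
  | .v i, .u j => if i = j then -1 else 0
  | _, _ => 0

/-- The commutation relations of `A_{r,s}`. -/
abbrev weylRelations (r s : ℕ) : Finset (FreeAlgebra ℤ (WeylPolyGen r s)) :=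
  commutationRelations fun g h => algebraMap ℤ _ (weylBracket g h)

lemma forall_weylRelations {E : Type} [Ring E] {e : WeylPolyGen r s → E} :
    (∀ w ∈ weylRelations r s, FreeAlgebra.lift ℤ e w = 0) ↔
      ∀ g h, e g * e h - e h * e g = (weylBracket g h : E) := by
  simp [weylRelations, forall_commutationRelations]

variable (F : Type) [Field F]

/-- The generators of `A_{r,s}(F)`. -/
def weylGen (g : WeylPolyGen r s) : WeylPolyAlgebra F r s :=
  RingQuot.mkAlgHom F (WeylPolyRel F r s) (FreeAlgebra.ι F g)

lemma weylGen_commutator (g h : WeylPolyGen r s) :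
    weylGen F g * weylGen F h - weylGen F h * weylGen F g = weylBracket g h := by
  have rel : ∀ {a b}, WeylPolyRel F r s a b →
      RingQuot.mkAlgHom F (WeylPolyRel F r s) a = RingQuot.mkAlgHom F (WeylPolyRel F r s) b :=
    fun h => RingQuot.mkAlgHom_rel F h
  have huv : ∀ i j : Fin r, (weylGen F (.u i) * weylGen F (.v j) : WeylPolyAlgebra F r s) =
      weylGen F (.v j) * weylGen F (.u i) + if i = j then 1 else 0 := by
    intro i j
    have := rel (WeylPolyRel.uv (s := s) i j)
    split_ifs with h <;> simpa [weylGen, h] using this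
  cases g with
  | u i =>
    cases h with
    | u j => simpa [weylGen, weylBracket, sub_eq_zero] using rel (WeylPolyRel.uu (s := s) i j)
    | v j => rw [huv]; simp [weylBracket]
    | y k => simpa [weylGen, weylBracket, sub_eq_zero] using (rel (WeylPolyRel.central k _)).symm
  | v i =>
    cases h with
    | u j =>
      rw [huv]
      by_cases hij : i = j <;> simp [weylBracket, hij, eq_comm]
    | v j => simpa [weylGen, weylBracket, sub_eq_zero] using rel (WeylPolyRel.vv (s := s) i j)
    | y k => simpa [weylGen, weylBracket, sub_eq_zero] using (rel (WeylPolyRel.central k _)).symm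
  | y k =>
    simpa [weylGen, weylBracket, sub_eq_zero] using rel (WeylPolyRel.central k h)

lemma weylPolyAlgebra_isPresented :
    IsPresented F (weylRelations r s) (weylGen F : WeylPolyGen r s → WeylPolyAlgebra F r s) where
  rel := forall_weylRelations.2 (weylGen_commutator F)
  exists_lift E _ _ e he := by
    rw [forall_weylRelations] at he
    have hrel : ∀ ⦃a b⦄, WeylPolyRel F r s a b →
        FreeAlgebra.lift F e a = FreeAlgebra.lift F e b := by
      intro a b hab
      cases hab with
      | uu i j => simpa [weylBracket, sub_eq_zero] using he (.u i) (.u j)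
      | vv i j => simpa [weylBracket, sub_eq_zero] using he (.v i) (.v j)
      | uv i j =>
        have := sub_eq_iff_eq_add'.1 (he (.u i) (.v j))
        split_ifs with h <;> simpa [weylBracket, h] using this
      | central k g => simpa [weylBracket, sub_eq_zero] using he (.y k) g
    exact ⟨RingQuot.liftAlgHom F ⟨FreeAlgebra.lift F e, hrel⟩, fun g => by simp [weylGen]⟩

lemma adjoin_range_weylGen :
    Algebra.adjoin F (Set.range (weylGen F : WeylPolyGen r s → WeylPolyAlgebra F r s)) = ⊤ := by
  have : Set.range (weylGen F : WeylPolyGen r s → WeylPolyAlgebra F r s) =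
      RingQuot.mkAlgHom F (WeylPolyRel F r s) '' Set.range (FreeAlgebra.ι F) := by
    rw [← Set.range_comp]
    rfl
  rw [this, ← AlgHom.map_adjoin, FreeAlgebra.adjoin_range_ι, Algebra.map_top, AlgHom.range_eq_top]
  exact RingQuot.mkAlgHom_surjective F _

/-- The derivation part of the action of a generator on polynomials. -/
def weylDer : WeylPolyGen r s →
    Derivation F (MvPolynomial (WeylPolyGen r s) F) (MvPolynomial (WeylPolyGen r s) F)
  | .u i => pderiv (.v i)
  | _ => 0

lemma weylDer_X (g h : WeylPolyGen r s) :
    weylDer F g (X h) = if weylBracket g h = 1 then 1 else 0 := by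
  classical
  cases g <;> cases h <;> simp [weylDer, weylBracket, pderiv_X, Pi.single_apply, eq_comm]
  split_ifs <;> simp

lemma weylPolyAlgebra_hasPBW :
    HasPBW F (weylGen F : WeylPolyGen r s → WeylPolyAlgebra F r s) where
  adjoin_eq_top := adjoin_range_weylGen F
  commutator_mem g h := by
    rw [weylGen_commutator, ← zsmul_one]
    exact zsmul_mem (one_mem_wordFil two_pos) _
  exists_symbol := by
    classical
    obtain ⟨ρ, hρ⟩ := (weylPolyAlgebra_isPresented F).exists_lift
      (Module.End F (MvPolynomial (WeylPolyGen r s) F)) (fun g => derivOp (weylDer F g) (X g)) <| by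
      rw [forall_weylRelations]
      intro g h
      have h0 : ⁅weylDer F g, weylDer F h⁆ = 0 := by
        refine derivation_ext fun i => ?_
        simp only [Derivation.commutator_apply, weylDer_X]
        split_ifs <;> simp
      rw [derivOp_commutator, h0, weylDer_X, weylDer_X]
      refine LinearMap.ext fun f => ?_
      cases g <;> cases h <;> simp [derivOp_apply, weylBracket]
      · rename_i i j
        by_cases hij : i = j
        · simp [hij]
        · simp [hij, eq_comm]
      · rename_i i j
        by_cases hij : i = j
        · simp [hij]
        · simp [hij, eq_comm]
    refine exists_symbol_of_derivOp (fun _ => 1) (weylDer F) X ρ (AlgHom.id F _) hρ ?_ ?_ ?_ ?_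
    · intro g h
      rw [weylDer_X]
      split_ifs
      · exact one_mem_wordFil two_pos
      · exact zero_mem _
    · exact fun g => gen_mem_wordFil g
    · exact fun g => gen_mem_wordFil g
    · exact fun g => rfl

lemma weylPolyAlgebra_exists_isCentralPoly (p : ℕ) [Fact p.Prime] [CharP F p] :
    ∃ τ : MvPolynomial (WeylPolyGen r s) F →ₐ[F] WeylPolyAlgebra F r s, IsCentralPoly τ := by
  have hp := (Fact.out : p.Prime).two_le
  have hgen : ∀ g h : WeylPolyGen r s,
      weylGen F g ^ p * weylGen F h = weylGen F h * weylGen F g ^ p := by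
    intro g h
    rw [← sub_eq_zero, pow_char_commutator (F := F)]
    obtain ⟨q, rfl⟩ := Nat.exists_eq_add_of_le' hp
    rw [Function.iterate_add_apply]
    simp only [Function.iterate_succ, Function.iterate_zero, Function.comp_apply, id]
    rw [weylGen_commutator, (Int.commute_cast _ _).eq, sub_self]
    exact Function.iterate_fixed (by simp) q
  refine ⟨_, (weylPolyAlgebra_hasPBW F).isCentralPoly hp (fun g => weylGen F g ^ p) ?_ (by simp)⟩
  intro g b
  have hb : b ∈ Algebra.adjoin F (Set.range (weylGen F : WeylPolyGen r s → _)) :=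
    adjoin_range_weylGen F ▸ Algebra.mem_top
  have := Algebra.adjoin_le_centralizer_centralizer F
    (Set.range (weylGen F : WeylPolyGen r s → _)) hb
  exact (this (weylGen F g ^ p) (by rintro _ ⟨h, rfl⟩; exact (hgen g h).symm))

end Weyl

/-! ### Enveloping algebras of Lie algebras with integral structure constants -/

section Enveloping

attribute [local instance] LieRing.ofAssociativeRing

variable {F L ι : Type} [Field F] [LieRing L] [LieAlgebra F L] [Fintype ι]

@[elab_as_elim]
lemma basis_induction {V : Type} [AddCommGroup V] [Module F V] (b : Module.Basis ι F V)
    {P : V → Prop} (basis : ∀ j, P (b j)) (zero : P 0) (add : ∀ x y, P x → P y → P (x + y))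
    (smul : ∀ (c : F) x, P x → P (c • x)) (x : V) : P x := by
  rw [← b.sum_repr x]
  exact Finset.sum_induction _ P add zero fun j _ => smul _ _ (basis j)

/-- The generators of the enveloping algebra given by a basis. -/
def envGen (b : Module.Basis ι F L) (j : ι) : UniversalEnvelopingAlgebra F L :=
  UniversalEnvelopingAlgebra.ι F (b j)

lemma ι_mem_span_envGen (b : Module.Basis ι F L) (A : L) :
    UniversalEnvelopingAlgebra.ι F A ∈ Submodule.span F (Set.range (envGen b)) := by
  rw [← b.sum_repr A, map_sum]
  exact sum_mem fun j _ => by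
    rw [map_smul]
    exact Submodule.smul_mem _ _ (Submodule.subset_span ⟨j, rfl⟩)

lemma ι_mem_lengthFil (b : Module.Basis ι F L) (A : L) {n : ℕ} (hn : 2 ≤ n) :
    UniversalEnvelopingAlgebra.ι F A ∈ lengthFil F (envGen b) n := by
  refine Submodule.span_le.2 ?_ (ι_mem_span_envGen b A)
  rintro _ ⟨j, rfl⟩
  exact wordFil_mono hn (gen_mem_wordFil j)

lemma adjoin_range_envGen (b : Module.Basis ι F L) :
    Algebra.adjoin F (Set.range (envGen b)) = ⊤ := by
  set S := Algebra.adjoin F (Set.range (envGen b))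
  have hι : ∀ A, UniversalEnvelopingAlgebra.ι F A ∈ S := fun A =>
    Algebra.span_le_adjoin F _ (ι_mem_span_envGen b A)
  let g : L →ₗ⁅F⁆ S :=
    { toFun := fun A => ⟨UniversalEnvelopingAlgebra.ι F A, hι A⟩
      map_add' := fun A A' => Subtype.ext (map_add _ A A')
      map_smul' := fun c A => Subtype.ext (map_smul _ c A)
      map_lie' := fun {A A'} => Subtype.ext (LieHom.map_lie _ A A') }
  have h : S.val.comp (UniversalEnvelopingAlgebra.lift F g) = AlgHom.id F _ := by
    refine UniversalEnvelopingAlgebra.hom_ext F (LieHom.ext fun A => ?_)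
    change (UniversalEnvelopingAlgebra.lift F g (UniversalEnvelopingAlgebra.ι F A) : _) =
      UniversalEnvelopingAlgebra.ι F A
    rw [UniversalEnvelopingAlgebra.lift_ι_apply]
    rfl
  refine eq_top_iff.2 fun a _ => ?_
  rw [← AlgHom.id_apply (R := F) a, ← h]
  exact SetLike.coe_mem _

/-- The commutation relations given by structure constants. -/
abbrev structureRelations (c : ι → ι → ι → ℤ) : Finset (FreeAlgebra ℤ ι) :=
  commutationRelations fun i j => ∑ k, c i j k • FreeAlgebra.ι ℤ k

lemma forall_structureRelations {c : ι → ι → ι → ℤ} {E : Type} [Ring E] {e : ι → E} :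
    (∀ w ∈ structureRelations c, FreeAlgebra.lift ℤ e w = 0) ↔
      ∀ i j, e i * e j - e j * e i = ∑ k, c i j k • e k := by
  simp [structureRelations, forall_commutationRelations]

lemma envelopingAlgebra_isPresented (b : Module.Basis ι F L) (c : ι → ι → ι → ℤ)
    (hc : ∀ i j, ⁅b i, b j⁆ = ∑ k, c i j k • b k) :
    IsPresented F (structureRelations c) (envGen b) where
  rel := by
    rw [forall_structureRelations]
    intro i j
    have := congrArg (UniversalEnvelopingAlgebra.ι F) (hc i j)
    rw [LieHom.map_lie, Ring.lie_def, map_sum] at this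
    simpa only [envGen, map_zsmul] using this
  exists_lift E _ _ e he := by
    rw [forall_structureRelations] at he
    let g := b.constr F e
    have hg : ∀ j, g (b j) = e j := b.constr_basis F e
    have hlie : ∀ A A', g ⁅A, A'⁆ = g A * g A' - g A' * g A := by
      have hbasis : ∀ i A', g ⁅b i, A'⁆ = g (b i) * g A' - g A' * g (b i) := by
        intro i A'
        induction A' using basis_induction b with
        | basis j => rw [hc, map_sum, hg, hg, he]; simp only [map_zsmul, hg]
        | zero => simp
        | add A A' hA hA' => rw [lie_add, map_add, map_add, hA, hA']; noncomm_ring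
        | smul c A hA => rw [lie_smul, map_smul, map_smul, hA, smul_sub, mul_smul_comm,
            smul_mul_assoc]
      intro A A'
      induction A using basis_induction b with
      | basis i => exact hbasis i A'
      | zero => simp
      | add A B hA hB => rw [add_lie, map_add, map_add, hA, hB]; noncomm_ring
      | smul c A hA => rw [smul_lie, map_smul, map_smul, hA, smul_sub, mul_smul_comm,
          smul_mul_assoc]
    let g' : L →ₗ⁅F⁆ E :=
      { g with map_lie' := fun {A A'} => (hlie A A').trans (Ring.lie_def _ _).symm }
    exact ⟨UniversalEnvelopingAlgebra.lift F g', fun j =>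
      (UniversalEnvelopingAlgebra.lift_ι_apply F g' _).trans (hg j)⟩

end Enveloping

/-! ### Enveloping algebras of matrix Lie algebras -/

section MatrixLie

attribute [local instance] LieRing.ofAssociativeRing

variable {F n ι : Type} [Field F] [Fintype n]

/-- The generic matrix. -/
def genericMatrix (F n ι : Type) [Field F] : Matrix n n (MvPolynomial ((n × n) ⊕ ι) F) :=
  Matrix.of fun a b => X (Sum.inl (a, b))

/-- The derivation with `T ↦ T A` on the generic matrix `T`. -/
def matrixDer (ι : Type) (A : Matrix n n F) :
    Derivation F (MvPolynomial ((n × n) ⊕ ι) F) (MvPolynomial ((n × n) ⊕ ι) F) :=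
  mkDerivation F (Sum.elim (fun q =>
    (genericMatrix F n ι * A.map (C : F → MvPolynomial ((n × n) ⊕ ι) F)) q.1 q.2) 0)

lemma matrixDer_genericMatrix (A : Matrix n n F) (B : Matrix n n F) (a b : n) :
    matrixDer ι A ((genericMatrix F n ι * B.map (C : F → MvPolynomial ((n × n) ⊕ ι) F)) a b) =
      (genericMatrix F n ι * (A * B).map (C : F → MvPolynomial ((n × n) ⊕ ι) F)) a b := by
  rw [Matrix.map_mul, ← Matrix.mul_assoc]
  conv_rhs => rw [Matrix.mul_apply]
  rw [Matrix.mul_apply, map_sum]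
  refine Finset.sum_congr rfl fun c _ => ?_
  simp [matrixDer, genericMatrix, Derivation.leibniz, mul_comm]

lemma matrixDer_add (A B : Matrix n n F) : matrixDer ι (A + B) = matrixDer ι A + matrixDer ι B := by
  refine derivation_ext fun q => ?_
  rcases q with q | j <;> simp [matrixDer, Matrix.map_add, Matrix.mul_add]

lemma matrixDer_smul (c : F) (A : Matrix n n F) : matrixDer ι (c • A) = c • matrixDer ι A := by
  refine derivation_ext fun q => ?_
  rcases q with q | j
  · simp only [matrixDer, mkDerivation_X, Sum.elim_inl, Derivation.smul_apply, Matrix.mul_apply,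
      Matrix.map_apply, Matrix.smul_apply, Finset.smul_sum, smul_eq_mul, map_mul, smul_eq_C_mul]
    exact Finset.sum_congr rfl fun a _ => by ring
  · simp [matrixDer]

lemma matrixDer_lie (A B : Matrix n n F) :
    ⁅matrixDer ι A, matrixDer ι B⁆ = matrixDer ι (A * B - B * A) := by
  have h : ∀ (A B : Matrix n n F) (q : n × n), matrixDer ι A (matrixDer ι B (X (Sum.inl q))) =
      (genericMatrix F n ι * (A * B).map (C : F → MvPolynomial ((n × n) ⊕ ι) F)) q.1 q.2 := by
    intro A B q
    rw [← matrixDer_genericMatrix]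
    simp [matrixDer]
  refine derivation_ext fun q => ?_
  rcases q with q | j
  · rw [Derivation.commutator_apply, h, h]
    simp [matrixDer, Matrix.map_sub, Matrix.mul_sub]
  · simp [matrixDer, Derivation.commutator_apply]

variable [Fintype ι]

/-- The linear form in the dual variables attached to a matrix. -/
def matrixForm (pos : ι → n × n) (A : Matrix n n F) : MvPolynomial ((n × n) ⊕ ι) F :=
  ∑ j, (genericMatrix F n ι * A.map (C : F → MvPolynomial ((n × n) ⊕ ι) F)) (pos j).1 (pos j).2 *
    X (Sum.inr j)

lemma matrixDer_matrixForm (pos : ι → n × n) (A B : Matrix n n F) :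
    matrixDer ι A (matrixForm pos B) = matrixForm pos (A * B) := by
  simp only [matrixForm, map_sum, Derivation.leibniz, matrixDer_genericMatrix]
  refine Finset.sum_congr rfl fun j _ => ?_
  simp [matrixDer, mul_comm]

lemma matrixForm_add (pos : ι → n × n) (A B : Matrix n n F) :
    matrixForm pos (A + B) = matrixForm pos A + matrixForm pos B := by
  simp [matrixForm, Matrix.map_add, Matrix.mul_add, add_mul, Finset.sum_add_distrib]

lemma matrixForm_smul (pos : ι → n × n) (c : F) (A : Matrix n n F) :
    matrixForm pos (c • A) = c • matrixForm pos A := by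
  simp only [matrixForm, Finset.smul_sum, Matrix.mul_apply, Finset.sum_mul, Matrix.map_apply,
    Matrix.smul_apply, smul_eq_mul, map_mul, smul_eq_C_mul]
  refine Finset.sum_congr rfl fun j _ => Finset.sum_congr rfl fun a _ => ?_
  ring

lemma matrixForm_sub (pos : ι → n × n) (A B : Matrix n n F) :
    matrixForm pos (A - B) = matrixForm pos A - matrixForm pos B := by
  rw [eq_sub_iff_add_eq, ← matrixForm_add, sub_add_cancel]

variable [DecidableEq n]

/-- The action of matrices by first-order operators. -/
def matrixOp (pos : ι → n × n) :
    Matrix n n F →ₗ⁅F⁆ Module.End F (MvPolynomial ((n × n) ⊕ ι) F) where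
  toFun A := derivOp (matrixDer ι A) (matrixForm pos A)
  map_add' A B := by
    refine LinearMap.ext fun f => ?_
    simp only [derivOp_apply, LinearMap.add_apply, matrixDer_add, matrixForm_add,
      Derivation.add_apply]
    ring
  map_smul' c A := by
    refine LinearMap.ext fun f => ?_
    simp [derivOp_apply, matrixDer_smul, matrixForm_smul]
  map_lie' {A B} := by
    rw [Ring.lie_def, Ring.lie_def, derivOp_commutator, matrixDer_lie, matrixDer_matrixForm,
      matrixDer_matrixForm, matrixForm_sub]

variable {L : LieSubalgebra F (Matrix n n F)}

lemma envelopingAlgebra_hasPBW (b : Module.Basis ι F L) (pos : ι → n × n)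
    (hb : ∀ (A : L) j, b.repr A j = (A : Matrix n n F) (pos j).1 (pos j).2) :
    HasPBW F (envGen b) where
  adjoin_eq_top := adjoin_range_envGen b
  commutator_mem i j := by
    have := ι_mem_lengthFil b ⁅b i, b j⁆ le_rfl
    rwa [LieHom.map_lie, Ring.lie_def] at this
  exists_symbol := by
    classical
    have hT : ∀ (A : Matrix n n F) (a c : n),
        (genericMatrix F n ι * A.map (C : F → MvPolynomial ((n × n) ⊕ ι) F)) a c ∈
          wordFil F X (Sum.elim (fun _ => 0) fun _ => 1) 1 := by
      intro A a c
      rw [Matrix.mul_apply]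
      refine sum_mem fun d _ => ?_
      rw [Matrix.map_apply, mul_comm, ← smul_eq_C_mul]
      exact Submodule.smul_mem _ _ (gen_mem_wordFil (Sum.inl (a, d)))
    refine exists_symbol_of_derivOp (κ := (n × n) ⊕ ι) (Sum.elim (fun _ => 0) fun _ => 1)
      (fun j => matrixDer ι (b j : Matrix n n F)) (fun j => matrixForm pos (b j : Matrix n n F))
      (UniversalEnvelopingAlgebra.lift F ((matrixOp pos).comp L.incl))
      (aeval (Sum.elim (fun q => C ((1 : Matrix n n F) q.1 q.2)) X)) ?_ ?_ ?_ ?_ ?_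
    · exact fun j => UniversalEnvelopingAlgebra.lift_ι_apply F _ _
    · rintro j (q | k)
      · simpa [matrixDer] using hT _ q.1 q.2
      · simp [matrixDer]
    · exact fun j => sum_mem fun k _ =>
        mul_mem_wordFil (m := 1) (n := 2) (by omega) (hT _ _ _) (gen_mem_wordFil (Sum.inr k))
    · rintro (q | k)
      · rw [aeval_X, Sum.elim_inl]
        change C ((1 : Matrix n n F) q.1 q.2) ∈ lengthFil F X 1
        rw [C_eq_smul_one]
        exact Submodule.smul_mem _ _ (one_mem_wordFil one_pos)
      · rw [aeval_X]
        exact gen_mem_wordFil k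
    · intro j
      have h1 : ∀ (A : Matrix n n F) (a c : n),
          aeval (Sum.elim (fun q => C ((1 : Matrix n n F) q.1 q.2)) X :
            (n × n) ⊕ ι → MvPolynomial ι F)
              ((genericMatrix F n ι * A.map (C : F → MvPolynomial ((n × n) ⊕ ι) F)) a c) =
            C (A a c) := by
        intro A a c
        rw [← Matrix.one_mul A, Matrix.mul_apply, Matrix.mul_apply, map_sum, map_sum]
        simp [genericMatrix, algebraMap_eq]
      simp only [matrixForm, map_sum, map_mul, h1, aeval_X, Sum.elim_inr, ← hb,
        Module.Basis.repr_self]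
      simp [Finsupp.single_apply]

lemma envelopingAlgebra_exists_isCentralPoly (b : Module.Basis ι F L) (pos : ι → n × n)
    (hb : ∀ (A : L) j, b.repr A j = (A : Matrix n n F) (pos j).1 (pos j).2) (p : ℕ)
    [Fact p.Prime] [CharP F p] (hL : ∀ A ∈ L, A ^ p ∈ L) :
    ∃ τ : MvPolynomial ι F →ₐ[F] UniversalEnvelopingAlgebra F L, IsCentralPoly τ := by
  have hp := (Fact.out : p.Prime).two_le
  let z : L → UniversalEnvelopingAlgebra F L := fun A =>
    UniversalEnvelopingAlgebra.ι F A ^ p - UniversalEnvelopingAlgebra.ι F ⟨_, hL A A.2⟩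
  have hz : ∀ A B : L, z A * UniversalEnvelopingAlgebra.ι F B =
      UniversalEnvelopingAlgebra.ι F B * z A := by
    intro A B
    have key : ∀ q : ℕ, (fun u => UniversalEnvelopingAlgebra.ι F A * u -
        u * UniversalEnvelopingAlgebra.ι F A)^[q] (UniversalEnvelopingAlgebra.ι F B) =
        UniversalEnvelopingAlgebra.ι F ((fun B => ⁅A, B⁆)^[q] B) ∧
        (((fun B => ⁅A, B⁆)^[q] B : L) : Matrix n n F) =
          (fun u : Matrix n n F => (A : Matrix n n F) * u - u * (A : Matrix n n F))^[q] B := by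
      intro q
      induction q with
      | zero => exact ⟨rfl, rfl⟩
      | succ q ih =>
        simp only [Function.iterate_succ_apply', ih.1, LieHom.map_lie, Ring.lie_def,
          LieSubalgebra.coe_bracket, ih.2, and_self]
    have h1 := pow_char_commutator (F := F) p (UniversalEnvelopingAlgebra.ι F A)
      (UniversalEnvelopingAlgebra.ι F B)
    have h2 := pow_char_commutator (F := F) p (A : Matrix n n F) (B : Matrix n n F)
    rw [← (key p).2] at h2
    have h3 : (fun B => ⁅A, B⁆)^[p] B = ⁅(⟨_, hL A A.2⟩ : L), B⁆ := by
      refine Subtype.ext (h2.symm.trans ?_)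
      rw [LieSubalgebra.coe_bracket, Ring.lie_def]
    rw [(key p).1, h3, LieHom.map_lie, Ring.lie_def] at h1
    simp only [z, sub_mul, mul_sub]
    rw [sub_eq_sub_iff_add_eq_add] at h1 ⊢
    rw [h1, add_comm]
  refine ⟨_, (envelopingAlgebra_hasPBW b pos hb).isCentralPoly hp (fun j => z (b j)) ?_ ?_⟩
  · intro j a
    have ha : a ∈ Algebra.adjoin F (Set.range (envGen b)) :=
      adjoin_range_envGen b ▸ Algebra.mem_top
    exact Algebra.adjoin_le_centralizer_centralizer F _ ha (z (b j)) (by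
      rintro _ ⟨k, rfl⟩
      exact (hz (b j) (b k)).symm)
  · intro j
    change UniversalEnvelopingAlgebra.ι F (b j) ^ p - _ -
      UniversalEnvelopingAlgebra.ι F (b j) ^ p ∈ _
    rw [sub_sub_cancel_left]
    exact neg_mem (ι_mem_lengthFil b _ hp)

end MatrixLie

section Orthogonal

attribute [local instance] LieRing.ofAssociativeRing

open LieAlgebra.Orthogonal

variable {F n : Type} [Field F] [Fintype n] [LinearOrder n]

lemma so_apply_swap {A : Matrix n n F} (hA : A ∈ so n F) (a b : n) : A a b = -A b a := by
  rw [← Matrix.neg_apply, ← (mem_so n F A).1 hA, Matrix.transpose_apply]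

/-- The coordinates on skew-symmetric matrices given by the entries above the diagonal. -/
def soBasis (n : Type) [Fintype n] [LinearOrder n] (h2 : (2 : F) ≠ 0) :
    Module.Basis {q : n × n // q.1 < q.2} F (so n F) :=
  Module.Basis.ofEquivFun
    { toFun := fun A q => (A : Matrix n n F) q.1.1 q.1.2
      map_add' := fun _ _ => rfl
      map_smul' := fun _ _ => rfl
      invFun := fun c => ⟨Matrix.of fun a b => if h : a < b then c ⟨(a, b), h⟩ else
        if h : b < a then -c ⟨(b, a), h⟩ else 0, by
          rw [mem_so]
          ext a b
          rcases lt_trichotomy a b with h | rfl | h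
          · simp [h, h.not_gt]
          · simp
          · simp [h, h.not_gt]⟩
      left_inv := fun A => by
        ext a b
        rcases lt_trichotomy a b with h | rfl | h
        · simp [h]
        · have := so_apply_swap A.2 a a
          have h0 : (A : Matrix n n F) a a = 0 := by
            have h3 : (2 : F) * (A : Matrix n n F) a a = 0 := by linear_combination this
            exact (mul_eq_zero.1 h3).resolve_left h2
          simp [h0]
        · simp [h, h.not_gt, ← so_apply_swap A.2 a b]
      right_inv := fun c => by
        ext q
        simp [q.2] }

lemma soBasis_repr (h2 : (2 : F) ≠ 0) (A : so n F) (q : {q : n × n // q.1 < q.2}) :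
    (soBasis n h2).repr A q = (A : Matrix n n F) q.1.1 q.1.2 :=
  rfl

/-- The integral skew-symmetric matrices `E_{ab} - E_{ba}`. -/
def soMatrix (q : {q : n × n // q.1 < q.2}) : Matrix n n ℤ :=
  Matrix.single q.1.1 q.1.2 1 - Matrix.single q.1.2 q.1.1 1

lemma coe_soBasis (h2 : (2 : F) ≠ 0) (q : {q : n × n // q.1 < q.2}) :
    (soBasis n h2 q : Matrix n n F) = (soMatrix q).map (Int.castRingHom F) := by
  have hmem : (soMatrix q).map (Int.castRingHom F) ∈ so n F := by
    rw [mem_so]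
    ext a b
    simp only [soMatrix, Matrix.transpose_apply, Matrix.map_apply, Matrix.sub_apply,
      Matrix.neg_apply, Matrix.single_apply, map_sub]
    simp [and_comm]
  have h : soBasis n h2 q = ⟨_, hmem⟩ := by
    refine (soBasis n h2).ext_elem fun q' => ?_
    rw [Module.Basis.repr_self, soBasis_repr]
    have h3 : ¬ (q.1.2 = q'.1.1 ∧ q.1.1 = q'.1.2) := fun h =>
      absurd q.2 (by rw [h.1, h.2]; exact q'.2.not_gt)
    simp only [soMatrix, Matrix.map_apply, Matrix.sub_apply, Matrix.single_apply, if_neg h3,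
      Finsupp.single_apply, Subtype.ext_iff, Prod.ext_iff]
    split_ifs <;> simp
  rw [h]

/-- The structure constants of the orthogonal Lie algebras. -/
def soConst (i j k : {q : n × n // q.1 < q.2}) : ℤ :=
  (soMatrix i * soMatrix j - soMatrix j * soMatrix i) k.1.1 k.1.2

lemma soBasis_lie (h2 : (2 : F) ≠ 0) (i j : {q : n × n // q.1 < q.2}) :
    ⁅soBasis n h2 i, soBasis n h2 j⁆ = ∑ k, soConst i j k • soBasis n h2 k := by
  refine (soBasis n h2).ext_elem fun k => ?_
  rw [map_sum, Finsupp.finsetSum_apply, soBasis_repr, LieSubalgebra.coe_bracket, Ring.lie_def,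
    coe_soBasis, coe_soBasis, ← Matrix.map_mul, ← Matrix.map_mul]
  change Int.castRingHom F ((soMatrix i * soMatrix j) k.1.1 k.1.2) -
    Int.castRingHom F ((soMatrix j * soMatrix i) k.1.1 k.1.2) = _
  simp [Finsupp.single_apply, soConst]

lemma pow_mem_so {A : Matrix n n F} (hA : A ∈ so n F) {p : ℕ} (hp : Odd p) : A ^ p ∈ so n F := by
  rw [mem_so] at hA ⊢
  rw [Matrix.transpose_pow, hA, hp.neg_pow]

lemma envelopingAlgebra_so_isPresented (n : Type) [Fintype n] [LinearOrder n] (h2 : (2 : F) ≠ 0) :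
    IsPresented F (structureRelations soConst) (envGen (soBasis n h2)) :=
  envelopingAlgebra_isPresented _ _ (soBasis_lie h2)

lemma envelopingAlgebra_so_hasPBW (n : Type) [Fintype n] [LinearOrder n] (h2 : (2 : F) ≠ 0) :
    HasPBW F (envGen (soBasis n h2)) :=
  envelopingAlgebra_hasPBW _ Subtype.val (soBasis_repr h2)

lemma envelopingAlgebra_so_exists_isCentralPoly (n : Type) [Fintype n] [LinearOrder n]
    (h2 : (2 : F) ≠ 0) (p : ℕ) [Fact p.Prime] [CharP F p] (hp : Odd p) :
    ∃ τ : MvPolynomial {q : n × n // q.1 < q.2} F →ₐ[F] UniversalEnvelopingAlgebra F (so n F),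
      IsCentralPoly τ :=
  envelopingAlgebra_exists_isCentralPoly _ Subtype.val (soBasis_repr h2) p fun _ hA =>
    pow_mem_so hA hp

end Orthogonal

/-! ### Reduction modulo large primes -/

section Reduction

open PrimeSpectrum Filter

/-- A finitely generated domain of characteristic zero has points modulo all large primes. -/
lemma exists_forall_prime_hom (R : Type) [CommRing R] [IsDomain R] [CharZero R]
    [Algebra.FiniteType ℤ R] : ∃ N : ℕ, ∀ (p : ℕ) [Fact p.Prime], N < p →
      Nonempty (R →+* AlgebraicClosure (ZMod p)) := by
  have hfp : (algebraMap ℤ R).FinitePresentation :=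
    RingHom.finitePresentation_algebraMap.2 (Algebra.FinitePresentation.of_finiteType.1 ‹_›)
  obtain ⟨T, hT⟩ := exists_constructibleSetData_iff.2 (isConstructible_range_comap hfp)
  have hgen : (⊥ : PrimeSpectrum ℤ) ∈ T.toSet := by
    rw [hT]
    refine ⟨⊥, PrimeSpectrum.ext ?_⟩
    exact (RingHom.injective_iff_ker_eq_bot _).1 (FaithfulSMul.algebraMap_injective ℤ R)
  obtain ⟨C, hC, hg, hf⟩ : ∃ C ∈ T, (⊥ : PrimeSpectrum ℤ) ∈ zeroLocus (Set.range C.g) ∧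
      (⊥ : PrimeSpectrum ℤ) ∉ zeroLocus {C.f} := by
    obtain ⟨C, hC, h⟩ := Set.mem_iUnion₂.1 hgen
    exact ⟨C, hC, h⟩
  have hg0 : ∀ i, C.g i = 0 := fun i => by simpa using hg ⟨i, rfl⟩
  have hf0 : C.f ≠ 0 := fun h => hf (by simp [h])
  refine ⟨C.f.natAbs, fun p hp hpN => ?_⟩
  have hpf : ¬ (p : ℤ) ∣ C.f := fun h =>
    hf0 (Int.eq_zero_of_dvd_of_natAbs_lt_natAbs h (by simpa using hpN))
  have hprime : (Ideal.span {(p : ℤ)}).IsPrime :=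
    (Ideal.span_singleton_prime (by exact_mod_cast hp.out.ne_zero)).2
      (Nat.prime_iff_prime_int.1 hp.out)
  have hmem : (⟨_, hprime⟩ : PrimeSpectrum ℤ) ∈ T.toSet := by
    refine Set.mem_biUnion hC ⟨?_, fun h => hpf ?_⟩
    · rintro _ ⟨i, rfl⟩
      simp [hg0]
    · exact Ideal.mem_span_singleton.1 (h rfl)
  rw [hT] at hmem
  obtain ⟨P, hP⟩ := hmem
  obtain ⟨M, hM, hPM⟩ := P.asIdeal.exists_le_maximal P.isPrime.ne_top
  have hpM : ((p : ℕ) : R) ∈ M := by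
    refine hPM ?_
    have : (p : ℤ) ∈ (comap (algebraMap ℤ R) P).asIdeal := by
      rw [hP]
      exact Ideal.mem_span_singleton_self _
    simpa using this
  let _ := Ideal.Quotient.field M
  have hchar : CharP (R ⧸ M) p := by
    refine (CharP.charP_iff_prime_eq_zero hp.out).2 ?_
    rw [← map_natCast (Ideal.Quotient.mk M)]
    exact Ideal.Quotient.eq_zero_iff_mem.2 hpM
  let _ : Algebra (ZMod p) (R ⧸ M) := ZMod.algebra _ p
  have : Algebra.FiniteType (ZMod p) (R ⧸ M) := .of_restrictScalars_finiteType ℤ _ _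
  have : Module.Finite (ZMod p) (R ⧸ M) := finite_of_finite_type_of_isJacobsonRing _ _
  let φ : (R ⧸ M) →ₐ[ZMod p] AlgebraicClosure (ZMod p) := IsAlgClosed.lift
  exact ⟨(φ : (R ⧸ M) →+* AlgebraicClosure (ZMod p)).comp (Ideal.Quotient.mk M)⟩

/-- A map from `K` to an algebraically closed field of odd characteristic. -/
structure ReductionMap (K : Type) : Type where
  p : ℕ
  [prime : Fact p.Prime]
  odd : Odd p
  toFun : K → AlgebraicClosure (ZMod p)

attribute [instance] ReductionMap.prime

variable {K : Type} [Field K]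

/-- The ring generated by the elements of a set and their inverses. -/
def closureInv (S : Set K) : Subalgebra ℤ K :=
  Algebra.adjoin ℤ (S ∪ S⁻¹)

lemma closureInv_mono {S T : Set K} (h : S ⊆ T) : closureInv S ≤ closureInv T :=
  Algebra.adjoin_mono (Set.union_subset_union h (Set.inv_subset_inv.2 h))

lemma mem_closureInv {S : Set K} {a : K} (h : a ∈ S) : a ∈ closureInv S :=
  Algebra.subset_adjoin (Or.inl h)

lemma inv_mem_closureInv {S : Set K} {a : K} (h : a ∈ S) : a⁻¹ ∈ closureInv S :=
  Algebra.subset_adjoin (Or.inr (Set.inv_mem_inv.2 h))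

/-- The maps that are homomorphisms on the ring generated by `S` and the inverses. -/
def homOn (S : Set K) : Set (ReductionMap K) :=
  {i | ∃ g : closureInv S →+* AlgebraicClosure (ZMod i.p), ∀ a : closureInv S, i.toFun a = g a}

lemma homOn_anti {S T : Set K} (h : S ⊆ T) : homOn T ⊆ homOn S := by
  rintro i ⟨g, hg⟩
  refine ⟨g.comp (Subalgebra.inclusion (closureInv_mono h)).toRingHom, fun a => ?_⟩
  rw [RingHom.comp_apply, ← Subalgebra.coe_inclusion (closureInv_mono h) a]
  exact hg _

/-- The filter of reduction maps that are homomorphisms on large finitely generated subrings. -/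
def reductionFilter (K : Type) [Field K] : Filter (ReductionMap K) :=
  ⨅ S : Finset K, 𝓟 (homOn (S : Set K))

lemma mem_reductionFilter {Q : Set (ReductionMap K)} :
    Q ∈ reductionFilter K ↔ ∃ S : Finset K, homOn (S : Set K) ⊆ Q := by
  classical
  refine mem_iInf_of_directed (fun S T => ⟨S ∪ T, ?_, ?_⟩) Q
  · exact principal_mono.2 (homOn_anti (by simp))
  · exact principal_mono.2 (homOn_anti (by simp))

lemma isGermEmbedding_reductionFilter :
    IsGermEmbedding (reductionFilter K) fun i : ReductionMap K => i.toFun where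
  one := mem_reductionFilter.2 ⟨∅, by
    rintro i ⟨g, hg⟩
    exact (hg 1).trans (map_one g)⟩
  mul a b := by
    classical
    refine mem_reductionFilter.2 ⟨{a, b}, ?_⟩
    rintro i ⟨g, hg⟩
    have ha : a ∈ closureInv (({a, b} : Finset K) : Set K) := mem_closureInv (by simp)
    have hb : b ∈ closureInv (({a, b} : Finset K) : Set K) := mem_closureInv (by simp)
    change i.toFun _ = i.toFun _ * i.toFun _
    rw [hg ⟨a, ha⟩, hg ⟨b, hb⟩, ← map_mul]
    exact hg (⟨a, ha⟩ * ⟨b, hb⟩)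
  add a b := by
    classical
    refine mem_reductionFilter.2 ⟨{a, b}, ?_⟩
    rintro i ⟨g, hg⟩
    have ha : a ∈ closureInv (({a, b} : Finset K) : Set K) := mem_closureInv (by simp)
    have hb : b ∈ closureInv (({a, b} : Finset K) : Set K) := mem_closureInv (by simp)
    change i.toFun _ = i.toFun _ + i.toFun _
    rw [hg ⟨a, ha⟩, hg ⟨b, hb⟩, ← map_add]
    exact hg (⟨a, ha⟩ + ⟨b, hb⟩)
  ne_zero a ha0 := by
    refine mem_reductionFilter.2 ⟨{a}, ?_⟩
    rintro i ⟨g, hg⟩ h0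
    have ha : a ∈ closureInv (({a} : Finset K) : Set K) := mem_closureInv (by simp)
    have ha' : a⁻¹ ∈ closureInv (({a} : Finset K) : Set K) := inv_mem_closureInv (by simp)
    have h1 : g (⟨a, ha⟩ * ⟨a⁻¹, ha'⟩) = 1 := by
      rw [← map_one g]
      exact congrArg g (Subtype.ext (mul_inv_cancel₀ ha0))
    rw [map_mul, ← hg ⟨a, ha⟩, h0, zero_mul] at h1
    exact zero_ne_one h1

lemma exists_forall_prime_of_eventually [CharZero K] {Q : ReductionMap K → Prop}
    (hQ : ∀ᶠ i in reductionFilter K, Q i) : ∃ N : ℕ, ∀ (p : ℕ) [Fact p.Prime], N < p →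
      ∃ i : ReductionMap K, i.p = p ∧ Q i := by
  classical
  obtain ⟨S, hS⟩ := mem_reductionFilter.1 hQ
  have : Algebra.FiniteType ℤ (closureInv (S : Set K)) :=
    .adjoin_of_finite (S.finite_toSet.union S.finite_toSet.inv)
  obtain ⟨N, hN⟩ := exists_forall_prime_hom (closureInv (S : Set K))
  refine ⟨max N 2, fun p hp hpN => ?_⟩
  obtain ⟨g⟩ := hN p (lt_of_le_of_lt (le_max_left _ _) hpN)
  have hodd : Odd p := hp.out.odd_of_ne_two (lt_of_le_of_lt (le_max_right _ _) hpN).ne'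
  refine ⟨⟨p, hodd, fun a => if h : a ∈ closureInv (S : Set K) then g ⟨a, h⟩ else 0⟩, rfl,
    hS ⟨g, fun a => ?_⟩⟩
  exact dif_pos a.2

end Reduction

lemma two_ne_zero_of_odd_char (p : ℕ) [Fact p.Prime] (hp : Odd p) :
    (2 : AlgebraicClosure (ZMod p)) ≠ 0 := by
  intro h
  have h2 : p ∣ 2 :=
    (CharP.cast_eq_zero_iff (AlgebraicClosure (ZMod p)) p 2).1 (by exact_mod_cast h)
  rw [(Nat.prime_dvd_prime_iff_eq Fact.out Nat.prime_two).1 h2] at hp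
  exact absurd hp (by decide)

end ReductionModP

/-- **Reduction theorem, instantiated at the orthogonal Lie algebras.**  If the
Gelfand–Kirillov conjecture holds for `so_m` over an algebraically closed field `K` of
characteristic `0` (`m ≥ 5`), then there is an `N` such that for every prime `p > N` it
holds for `so_m` over an algebraic closure of `𝔽_p`. -/
theorem gelfandKirillov_reduction_so (K : Type) [Field K] [IsAlgClosed K] [CharZero K]
    (m : ℕ) (hm : 5 ≤ m)
    (h : GelfandKirillovHolds K (LieAlgebra.Orthogonal.so (Fin m) K)) :
    ∃ N : ℕ, ∀ (p : ℕ) [Fact p.Prime], N < p →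
      GelfandKirillovHolds (AlgebraicClosure (ZMod p))
        (LieAlgebra.Orthogonal.so (Fin m) (AlgebraicClosure (ZMod p))) := by
  obtain ⟨⟨r, s, D₁, D₂, f₁, f₂, frac₁, frac₂, iso⟩⟩ := h
  have frac : IsFractionDivisionRing K ((iso : D₁ →ₐ[K] D₂).comp f₁) := by
    refine ⟨iso.injective.comp frac₁.1, fun d => ?_⟩
    obtain ⟨a, b, hb, hd⟩ := frac₁.2 (iso.symm d)
    exact ⟨a, b, hb, by simpa using congrArg iso hd⟩
  have h2 := fun i : ReductionMap K => two_ne_zero_of_odd_char i.p i.odd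
  obtain ⟨N, hN⟩ := exists_forall_prime_of_eventually <|
    eventually_exists_isFractionDivisionRing
      isGermEmbedding_reductionFilter
      (envelopingAlgebra_so_isPresented (Fin m) two_ne_zero)
      (envelopingAlgebra_so_hasPBW (Fin m) two_ne_zero)
      (fun i => envelopingAlgebra_so_isPresented (Fin m) (h2 i))
      (fun i => envelopingAlgebra_so_hasPBW (Fin m) (h2 i))
      (weylPolyAlgebra_isPresented K) (weylPolyAlgebra_hasPBW K)
      (fun i => weylPolyAlgebra_isPresented (r := r) (s := s) _)
      (fun i => weylPolyAlgebra_hasPBW _) frac frac₂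
      (fun i => envelopingAlgebra_so_exists_isCentralPoly (Fin m) (h2 i) i.p i.odd)
      (fun i => weylPolyAlgebra_exists_isCentralPoly _ i.p)
  refine ⟨N, fun p _ hp => ?_⟩
  obtain ⟨i, rfl, D, _, _, φ, φ', hφ, hφ'⟩ := hN p hp
  exact ⟨⟨r, s, D, D, φ, φ', hφ, hφ', AlgEquiv.refl⟩⟩

end
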